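/- arXiv:1312.1106 — 6 statements merged into one kernel-verified Lean document; each statement's English description precedes it below -/
import Mathlib

section
/- If G is a claw-free hamiltonian graph of order n and maximum degree Δ with Δ ≥ 24, then the number s(G) of different cycle lengths of G satisfies s(G) ≥ min{n, ⌈(3/2)Δ⌉} − 2. -/
/-- A graph is claw-free if it contains no induced subgraph isomorphic to `K_{1,3}`,
i.e. there is no vertex `v` with three pairwise nonadjacent neighbors. -/
def ClawFree {V : Type*} (G : SimpleGraph V) : Prop :=
  ∀ v a b c : V, G.Adj v a → G.Adj v b → G.Adj v c →
    a ≠ b → a ≠ c → b ≠ c → ¬ G.Adj a b → ¬ G.Adj a c → ¬ G.Adj b c → False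

/-- `G` has a cycle of length `ℓ`. -/
def HasCycleLength {V : Type*} (G : SimpleGraph V) (ℓ : ℕ) : Prop :=
  ∃ (v : V) (w : G.Walk v v), w.IsCycle ∧ w.length = ℓ


section Kneser
open scoped Pointwise
open Finset

/-- `s` is a union of cosets of `K`. -/
def PeriodicUnder {α : Type*} [AddCommGroup α] (K : AddSubgroup α) (s : Finset α) : Prop :=
  ∀ x ∈ s, ∀ k ∈ K, x + k ∈ s

open Classical in
/-- The coset of `K` through `c`, as a finset. -/
noncomputable def cosetFinset {α : Type*} [AddCommGroup α] [Fintype α] (K : AddSubgroup α)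
    (c : α) : Finset α :=
  univ.filter fun x => x - c ∈ K

theorem mem_cosetFinset {α : Type*} [AddCommGroup α] [Fintype α] {K : AddSubgroup α} {c x : α} :
    x ∈ cosetFinset K c ↔ x - c ∈ K := by
  simp [cosetFinset]

theorem card_cosetFinset {α : Type*} [AddCommGroup α] [Fintype α] (K : AddSubgroup α) (c : α) :
    #(cosetFinset K c) = Nat.card K := by
  classical
  rw [Nat.card_eq_fintype_card, ← card_univ]
  refine (card_bij (fun (k : K) _ => (k : α) + c) ?_ ?_ ?_).symm
  · intro k _
    simp [mem_cosetFinset]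
  · intro a _ b _ hab
    exact Subtype.ext (add_right_cancel hab)
  · intro x hx
    exact ⟨⟨x - c, mem_cosetFinset.1 hx⟩, mem_univ _, by simp⟩

theorem PeriodicUnder.add_mem_iff {α : Type*} [AddCommGroup α] {K : AddSubgroup α} {s : Finset α}
    (h : PeriodicUnder K s) {x k : α} (hk : k ∈ K) : x + k ∈ s ↔ x ∈ s :=
  ⟨fun hx => by simpa using h _ hx _ (K.neg_mem hk), fun hx => h x hx k hk⟩

theorem PeriodicUnder.mem_iff_of_sub_mem {α : Type*} [AddCommGroup α] {K : AddSubgroup α}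
    {s : Finset α} (h : PeriodicUnder K s) {x y : α} (hk : y - x ∈ K) : y ∈ s ↔ x ∈ s := by
  simpa using h.add_mem_iff (x := x) hk

theorem PeriodicUnder.cosetFinset_subset {α : Type*} [AddCommGroup α] [Fintype α]
    {K : AddSubgroup α} {s : Finset α} (h : PeriodicUnder K s) {x : α} (hx : x ∈ s) :
    cosetFinset K x ⊆ s := fun _ hy =>
  (h.mem_iff_of_sub_mem (mem_cosetFinset.1 hy)).2 hx

theorem PeriodicUnder.disjoint_cosetFinset {α : Type*} [AddCommGroup α] [Fintype α]
    {K : AddSubgroup α} {s : Finset α} (h : PeriodicUnder K s) {x : α} (hx : x ∉ s) :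
    Disjoint (cosetFinset K x) s :=
  disjoint_left.2 fun _ hy hys => hx ((h.mem_iff_of_sub_mem (mem_cosetFinset.1 hy)).1 hys)

/-- Translating by a period of `s` preserves the size of the intersection with a coset. -/
theorem PeriodicUnder.card_cosetFinset_add_inter {α : Type*} [AddCommGroup α] [Fintype α]
    [DecidableEq α] {K L : AddSubgroup α} {s : Finset α} (h : PeriodicUnder L s) (c : α) {l : α}
    (hl : l ∈ L) : #(cosetFinset K (c + l) ∩ s) = #(cosetFinset K c ∩ s) := by
  refine (card_bij (fun x _ => x + l) ?_ ?_ ?_).symm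
  · intro x hx
    rw [mem_inter, mem_cosetFinset] at hx ⊢
    exact ⟨by simpa using hx.1, h _ hx.2 _ hl⟩
  · intro a _ b _ hab
    exact add_right_cancel hab
  · intro y hy
    rw [mem_inter, mem_cosetFinset] at hy
    refine ⟨y - l, ?_, by abel⟩
    rw [mem_inter, mem_cosetFinset]
    refine ⟨?_, by simpa [sub_eq_add_neg] using h _ hy.2 _ (L.neg_mem hl)⟩
    convert hy.1 using 1
    abel

/-- Cosets of `H` and of `K` overlap in at most one coset of `H ⊓ K`. -/
theorem card_inter_add_card_inter_le {α : Type*} [AddCommGroup α] [Fintype α] [DecidableEq α]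
    {H K : AddSubgroup α} (c d : α) {s t X : Finset α} (hs : cosetFinset H c ∩ s ⊆ X)
    (ht : cosetFinset K d ∩ t ⊆ X) :
    #(cosetFinset H c ∩ s) + #(cosetFinset K d ∩ t) ≤ #X + Nat.card (H ⊓ K : AddSubgroup α) := by
  rw [← card_union_add_card_inter]
  refine add_le_add (card_le_card (union_subset hs ht)) ?_
  rcases ((cosetFinset H c ∩ s) ∩ (cosetFinset K d ∩ t)).eq_empty_or_nonempty with h | ⟨z, hz⟩
  · simp [h]
  · rw [← card_cosetFinset (H ⊓ K) z]
    refine card_le_card fun y hy => ?_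
    simp only [mem_inter, mem_cosetFinset] at hz hy ⊢
    refine AddSubgroup.mem_inf.2 ⟨?_, ?_⟩
    · have := H.sub_mem hy.1.1 hz.1.1
      simpa using this
    · have := K.sub_mem hy.2.1 hz.2.1
      simpa using this

/-- If `s` is not contained in `t`, then `s \ t` is at least as large as one of the two period
groups, or the symmetric difference of `s` and `t` is large. -/
theorem card_le_card_sdiff_of_periodicUnder {α : Type*} [AddCommGroup α] [Fintype α] [DecidableEq α]
    {H K : AddSubgroup α} {s t : Finset α} (hs : PeriodicUnder H s) (ht : PeriodicUnder K t)
    {c : α} (hcs : c ∈ s) (hct : c ∉ t) :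
    Nat.card H ≤ #(s \ t) ∨ Nat.card K ≤ #(s \ t) ∨
      Nat.card H + Nat.card K ≤ #(s \ t) + #(t \ s) + 2 * Nat.card (H ⊓ K : AddSubgroup α) := by
  by_cases h₁ : ∃ h ∈ H, c + h ∈ t
  swap
  · left
    rw [← card_cosetFinset H c]
    refine card_le_card fun x hx => mem_sdiff.2 ⟨hs.cosetFinset_subset hcs hx, fun hxt => h₁ ?_⟩
    exact ⟨x - c, mem_cosetFinset.1 hx, by simpa using hxt⟩
  by_cases h₂ : ∃ k ∈ K, c + k ∉ s
  swap
  · right; left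
    push Not at h₂
    rw [← card_cosetFinset K c]
    refine card_le_card fun x hx => mem_sdiff.2 ⟨?_, ?_⟩
    · simpa using h₂ (x - c) (mem_cosetFinset.1 hx)
    · exact disjoint_left.1 (ht.disjoint_cosetFinset hct) hx
  right; right
  obtain ⟨h, hh, hht⟩ := h₁
  obtain ⟨k, hk, hks⟩ := h₂
  have e₁ : #(cosetFinset H c ∩ tᶜ) + #(cosetFinset K c ∩ s) ≤
      #(s \ t) + Nat.card (H ⊓ K : AddSubgroup α) := by
    refine card_inter_add_card_inter_le c c (fun x hx => ?_) fun x hx => ?_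
    · rw [mem_inter, mem_compl] at hx
      exact mem_sdiff.2 ⟨hs.cosetFinset_subset hcs hx.1, hx.2⟩
    · rw [mem_inter] at hx
      exact mem_sdiff.2 ⟨hx.2, disjoint_left.1 (ht.disjoint_cosetFinset hct) hx.1⟩
  have e₂ : #(cosetFinset H (c + k) ∩ t) + #(cosetFinset K (c + h) ∩ sᶜ) ≤
      #(t \ s) + Nat.card (H ⊓ K : AddSubgroup α) := by
    refine card_inter_add_card_inter_le _ _ (fun x hx => ?_) fun x hx => ?_
    · rw [mem_inter] at hx
      exact mem_sdiff.2 ⟨hx.2, disjoint_left.1 (hs.disjoint_cosetFinset hks) hx.1⟩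
    · rw [mem_inter, mem_compl] at hx
      exact mem_sdiff.2 ⟨ht.cosetFinset_subset hht hx.1, hx.2⟩
  have hsc : PeriodicUnder H sᶜ := fun x hx l hl => by
    rw [mem_compl] at hx ⊢
    rwa [hs.add_mem_iff hl]
  rw [ht.card_cosetFinset_add_inter c hk, hsc.card_cosetFinset_add_inter c hh] at e₂
  have e₃ := card_inter_add_card_sdiff (cosetFinset H c) t
  have e₄ := card_inter_add_card_sdiff (cosetFinset K c) s
  rw [sdiff_eq_inter_compl, card_cosetFinset] at e₃ e₄
  omega

/-- The union of two periodic sets is periodic under a subgroup that is large compared to the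
size of the union. -/
theorem exists_periodicUnder_union {α : Type*} [AddCommGroup α] [Fintype α] [DecidableEq α]
    {H K : AddSubgroup α} {s t : Finset α} (hs : PeriodicUnder H s) (ht : PeriodicUnder K t)
    {n : ℕ} (hns : n ≤ #s + Nat.card H) (hnt : n ≤ #t + Nat.card K) :
    ∃ L : AddSubgroup α, PeriodicUnder L (s ∪ t) ∧ n ≤ #(s ∪ t) + Nat.card L := by
  by_cases hst : s ⊆ t
  · exact ⟨K, by rwa [union_eq_right.2 hst], by rwa [union_eq_right.2 hst]⟩
  by_cases hts : t ⊆ s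
  · exact ⟨H, by rwa [union_eq_left.2 hts], by rwa [union_eq_left.2 hts]⟩
  obtain ⟨c, hcs, hct⟩ := not_subset.1 hst
  obtain ⟨d, hdt, hds⟩ := not_subset.1 hts
  refine ⟨H ⊓ K, fun x hx l hl => ?_, ?_⟩
  · rw [AddSubgroup.mem_inf] at hl
    rw [mem_union] at hx ⊢
    exact hx.imp (fun h => hs _ h _ hl.1) fun h => ht _ h _ hl.2
  · have e₁ := card_le_card_sdiff_of_periodicUnder hs ht hcs hct
    have e₂ := card_le_card_sdiff_of_periodicUnder ht hs hdt hds
    rw [inf_comm] at e₂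
    have e₃ : #(s ∪ t) = #t + #(s \ t) := by rw [← card_sdiff_add_card]; omega
    have e₄ : #(s ∪ t) = #s + #(t \ s) := by
      rw [union_comm, ← card_sdiff_add_card]; omega
    omega

theorem mem_stabilizer_iff_forall_add_mem {α : Type*} [AddCommGroup α] [DecidableEq α]
    (s : Finset α) (k : α) : k ∈ AddAction.stabilizer α s ↔ ∀ a ∈ s, a + k ∈ s := by
  rw [AddAction.mem_stabilizer_finset']
  simp only [vadd_eq_add, add_comm k]

open Classical in
/-- Repeated Dyson transforms: a sumset contains a large periodic set around each translate. -/
theorem exists_periodicUnder_of_mem {α : Type*} [AddCommGroup α] [Fintype α] [DecidableEq α]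
    {A B : Finset α} {b : α} (hb : b ∈ B) :
    ∃ (C : Finset α) (K : AddSubgroup α), (∀ a ∈ A, a + b ∈ C) ∧ C ⊆ A + B ∧
      PeriodicUnder K C ∧ #A + #B ≤ #C + Nat.card K := by
  induction hn : #B using Nat.strong_induction_on generalizing A B with
  | _ n ih =>
  by_cases hstab : ∀ a ∈ A, ∀ x ∈ B, a - b + x ∈ A
  · let K : AddSubgroup α := AddAction.stabilizer α A
    have hK : ∀ k, k ∈ K ↔ ∀ a ∈ A, a + k ∈ A := mem_stabilizer_iff_forall_add_mem A
    refine ⟨A.image (· + b), K, fun a ha => mem_image_of_mem _ ha, ?_, ?_, ?_⟩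
    · intro x hx
      obtain ⟨a, ha, rfl⟩ := mem_image.1 hx
      exact add_mem_add ha hb
    · intro x hx k hk
      obtain ⟨a, ha, rfl⟩ := mem_image.1 hx
      exact mem_image.2 ⟨a + k, (hK k).1 hk a ha, by abel⟩
    · rw [card_image_of_injective _ (add_left_injective b), ← hn, ← card_cosetFinset K b]
      refine Nat.add_le_add_left
        (card_le_card fun x hx => mem_cosetFinset.2 ((hK _).2 fun a ha => ?_)) _
      convert hstab a ha x hx using 1
      abel
  · push Not at hstab
    obtain ⟨a, ha, x, hx, hax⟩ := hstab
    let B' := B.image (fun y => y + (a - b))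
    have hB' : ∀ y, y ∈ B' ↔ y - (a - b) ∈ B := fun y => by
      simp only [B', mem_image]
      exact ⟨by rintro ⟨z, hz, rfl⟩; simpa using hz, fun h => ⟨_, h, by abel⟩⟩
    let B₁ := B.filter fun y => y + (a - b) ∈ A
    have hbB₁ : b ∈ B₁ := mem_filter.2 ⟨hb, by simpa using ha⟩
    have hcardB' : #B' = #B := card_image_of_injective _ (add_left_injective _)
    have hcardB₁ : #B₁ = #(A ∩ B') := by
      have : B₁.image (fun y => y + (a - b)) = A ∩ B' := by
        ext y
        simp only [B₁, mem_image, mem_filter, mem_inter, hB']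
        constructor
        · rintro ⟨z, ⟨hz, hz'⟩, rfl⟩
          exact ⟨hz', by simpa using hz⟩
        · rintro ⟨h₁, h₂⟩
          exact ⟨_, ⟨h₂, by simpa using h₁⟩, by abel⟩
      rw [← this, card_image_of_injective _ (add_left_injective _)]
    have hlt : #B₁ < n := by
      rw [← hn]
      refine card_lt_card ⟨filter_subset _ _, fun h => hax ?_⟩
      rw [add_comm]
      exact (mem_filter.1 (h hx)).2
    obtain ⟨C, K, hC, hCs, hper, hcard⟩ := ih _ hlt (A := A ∪ B') hbB₁ rfl
    refine ⟨C, K, fun z hz => hC z (mem_union_left _ hz), hCs.trans ?_, hper, ?_⟩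
    · intro z hz
      obtain ⟨p, hp, q, hq, rfl⟩ := mem_add.1 hz
      rw [mem_filter] at hq
      rcases mem_union.1 hp with hp | hp
      · exact add_mem_add hp hq.1
      · rw [hB'] at hp
        have := add_mem_add hq.2 hp
        convert this using 1
        abel
    · have := card_union_add_card_inter A B'
      omega

/-- **Kneser's theorem**, in a weak form. -/
theorem exists_periodicUnder_add {α : Type*} [AddCommGroup α] [Fintype α] [DecidableEq α]
    {A B : Finset α} (hB : B.Nonempty) :
    ∃ K : AddSubgroup α, PeriodicUnder K (A + B) ∧ #A + #B ≤ #(A + B) + Nat.card K := by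
  have key : ∀ F : Finset α, F.Nonempty → F ⊆ B → ∃ (C : Finset α) (K : AddSubgroup α),
      A + F ⊆ C ∧ C ⊆ A + B ∧ PeriodicUnder K C ∧ #A + #B ≤ #C + Nat.card K := by
    intro F hF
    induction hF using Finset.Nonempty.cons_induction with
    | singleton b =>
      intro hb
      obtain ⟨C, K, hC, h⟩ := exists_periodicUnder_of_mem (A := A) (singleton_subset_iff.1 hb)
      refine ⟨C, K, fun x hx => ?_, h⟩
      obtain ⟨a, ha, y, hy, rfl⟩ := mem_add.1 hx
      rw [mem_singleton.1 hy]
      exact hC a ha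
    | cons b F hbF hF ih =>
      intro hsub
      rw [cons_subset] at hsub
      obtain ⟨C, K, hC, hCs, hper, hcard⟩ := ih hsub.2
      obtain ⟨C', K', hC', hCs', hper', hcard'⟩ := exists_periodicUnder_of_mem (A := A) hsub.1
      obtain ⟨L, hL, hLcard⟩ := exists_periodicUnder_union hper hper' hcard hcard'
      refine ⟨C ∪ C', L, fun x hx => ?_, union_subset hCs hCs', hL, hLcard⟩
      obtain ⟨a, ha, y, hy, rfl⟩ := mem_add.1 hx
      rcases mem_cons.1 hy with rfl | hy
      · exact mem_union_right _ (hC' a ha)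
      · exact mem_union_left _ (hC (add_mem_add ha hy))
  obtain ⟨C, K, hC, hCs, h⟩ := key B hB subset_rfl
  rw [hCs.antisymm hC] at h
  exact ⟨K, h⟩

open Classical in
/-- **Kneser's theorem**, with one summand replaced by a union of cosets. -/
theorem kneser_add_cosets {α : Type*} [AddCommGroup α] [Fintype α] [DecidableEq α]
    {A B : Finset α} (hB : B.Nonempty) :
    ∃ K : AddSubgroup α, PeriodicUnder K (A + B) ∧
      #A + #(B.biUnion (cosetFinset K)) ≤ #(A + B) + Nat.card K := by
  let K : AddSubgroup α := AddAction.stabilizer α (A + B)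
  have hK : PeriodicUnder K (A + B) := fun x hx k hk =>
    (mem_stabilizer_iff_forall_add_mem _ _).1 hk x hx
  have hBsub : B ⊆ B.biUnion (cosetFinset K) := fun x hx =>
    mem_biUnion.2 ⟨x, hx, mem_cosetFinset.2 (by simp)⟩
  have hsum : A + B.biUnion (cosetFinset K) = A + B := by
    refine subset_antisymm (fun x hx => ?_) (add_subset_add_left hBsub)
    obtain ⟨a, ha, y, hy, rfl⟩ := mem_add.1 hx
    obtain ⟨b, hb, hyb⟩ := mem_biUnion.1 hy
    refine (hK.mem_iff_of_sub_mem ?_).2 (add_mem_add ha hb)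
    simpa using mem_cosetFinset.1 hyb
  obtain ⟨L, hL, hcard⟩ := exists_periodicUnder_add (A := A) (hB.mono hBsub)
  rw [hsum] at hL hcard
  refine ⟨K, hK, hcard.trans (Nat.add_le_add_left ?_ _)⟩
  exact AddSubgroup.card_le_of_le fun l hl =>
    (mem_stabilizer_iff_forall_add_mem _ _).2 fun x hx => hL x hx l hl

end Kneser

section Core
open scoped Pointwise
open Finset

theorem ZMod.natCast_eq_natCast_of_le_two_mul {N a i : ℕ} (ha : 1 ≤ a) (ha' : a ≤ 2 * N)
    (hi : 1 ≤ i) (hi' : i ≤ N) (h : (a : ZMod N) = i) : a = i ∨ a = i + N := by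
  rw [ZMod.natCast_eq_natCast_iff] at h
  obtain ⟨k, hk⟩ := h.symm.dvd
  have h₁ : k < 2 := by
    by_contra hk2
    nlinarith [show (2 : ℤ) ≤ k by omega]
  have h₂ : -1 < k := by
    by_contra hk2
    nlinarith [show k ≤ (-1 : ℤ) by omega]
  obtain rfl | rfl : k = 0 ∨ k = 1 := by omega
  · left; omega
  · right; omega

theorem ZMod.natCast_injOn_Icc (N : ℕ) : Set.InjOn (fun a : ℕ => (a : ZMod N)) (Icc 1 N) := by
  intro a ha b hb hab
  rw [mem_coe, mem_Icc] at ha hb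
  have := ZMod.natCast_eq_natCast_of_le_two_mul ha.1 (by omega) hb.1 hb.2 hab
  omega

open Classical in
/-- The number of elements of a subset of `[1, N]` with residues modulo `N` in a prescribed set. -/
theorem card_filter_natCast_mem {N : ℕ} {s : Finset ℕ} (hs : s ⊆ Icc 1 N) (X : Finset (ZMod N)) :
    #(s.filter fun i : ℕ => (i : ZMod N) ∈ X) = #(X ∩ s.image fun i : ℕ => (i : ZMod N)) := by
  rw [← card_image_of_injOn ((ZMod.natCast_injOn_Icc N).mono fun x hx =>
    hs (filter_subset _ _ (mem_coe.1 hx)))]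
  congr 1
  ext x
  simp only [mem_image, mem_filter, mem_inter]
  constructor
  · rintro ⟨i, ⟨hi, hx⟩, rfl⟩
    exact ⟨hx, i, hi, rfl⟩
  · rintro ⟨hx, i, hi, rfl⟩
    exact ⟨i, ⟨hi, hx⟩, rfl⟩

open Classical in
/-- Sums of integers from two residue cosets modulo `N`: those exceeding `N` avoid `I`, so there
cannot be many sums in total. -/
theorem card_coset_add_le {N : ℕ} [NeZero N] {I M : Finset ℕ} (hI : I ⊆ Icc 1 N)
    (hM : M ⊆ Icc 1 N) (hW : ∀ i ∈ I, ∀ j ∈ I, ∀ m ∈ M, i + m ≠ j + N)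
    (K : AddSubgroup (ZMod N)) (c d : ZMod N)
    (hc : (cosetFinset K c ∩ I.image fun i : ℕ => (i : ZMod N)).Nonempty)
    (hd : (cosetFinset K d ∩ M.image fun i : ℕ => (i : ZMod N)).Nonempty) :
    #(cosetFinset K c ∩ I.image fun i : ℕ => (i : ZMod N)) +
      #(cosetFinset K d ∩ M.image fun i : ℕ => (i : ZMod N)) ≤
      Nat.card K + #(cosetFinset K (c + d) \ I.image fun i : ℕ => (i : ZMod N)) + 1 := by
  rw [← card_pos] at hc hd
  rw [← card_filter_natCast_mem hI] at hc ⊢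
  rw [← card_filter_natCast_mem hM] at hd ⊢
  set A := I.filter fun i : ℕ => (i : ZMod N) ∈ cosetFinset K c
  set B := M.filter fun i : ℕ => (i : ZMod N) ∈ cosetFinset K d
  have hAB : ∀ x ∈ A + B, 1 ≤ x ∧ x ≤ 2 * N ∧ (x : ZMod N) ∈ cosetFinset K (c + d) ∧
      ∀ j ∈ I, x ≠ j + N := by
    intro x hx
    obtain ⟨a, ha, b, hb, rfl⟩ := mem_add.1 hx
    obtain ⟨haI, hac⟩ := mem_filter.1 ha
    obtain ⟨hbM, hbd⟩ := mem_filter.1 hb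
    have h₁ := mem_Icc.1 (hI haI)
    have h₂ := mem_Icc.1 (hM hbM)
    refine ⟨by omega, by omega, ?_, fun j hj => hW a haI j hj b hbM⟩
    rw [mem_cosetFinset] at hac hbd ⊢
    convert K.add_mem hac hbd using 1
    push_cast
    abel
  have hsum : #A + #B - 1 ≤ #(A + B) :=
    cauchy_davenport_add_of_linearOrder_isCancelAdd (card_pos.1 hc) (card_pos.1 hd)
  have hsmall : #{x ∈ A + B | x ≤ N} ≤ Nat.card K := by
    rw [← card_cosetFinset K (c + d)]
    refine card_le_card_of_injOn (fun i : ℕ => (i : ZMod N)) (fun x hx => ?_) fun x hx y hy hxy => ?_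
    · exact (hAB x (mem_filter.1 (mem_coe.1 hx)).1).2.2.1
    · rw [mem_coe, mem_filter] at hx hy
      exact ZMod.natCast_injOn_Icc N (by simpa using ⟨(hAB x hx.1).1, hx.2⟩)
        (by simpa using ⟨(hAB y hy.1).1, hy.2⟩) hxy
  have hlarge : #{x ∈ A + B | ¬ x ≤ N} ≤
      #(cosetFinset K (c + d) \ I.image fun i : ℕ => (i : ZMod N)) := by
    refine card_le_card_of_injOn (fun i : ℕ => (i : ZMod N)) (fun x hx => ?_) fun x hx y hy hxy => ?_
    · rw [mem_coe, mem_filter] at hx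
      obtain ⟨h₁, h₂, h₃, h₄⟩ := hAB x hx.1
      refine mem_sdiff.2 ⟨h₃, fun hmem => ?_⟩
      obtain ⟨j, hj, hjx⟩ := mem_image.1 hmem
      have h₅ := mem_Icc.1 (hI hj)
      rcases ZMod.natCast_eq_natCast_of_le_two_mul h₁ h₂ h₅.1 h₅.2 hjx.symm with h | h
      · omega
      · exact h₄ j hj h
    · rw [mem_coe, mem_filter] at hx hy
      have h₁ := hAB x hx.1
      have h₂ := hAB y hy.1
      have h : ((x - N : ℕ) : ZMod N) = ((y - N : ℕ) : ZMod N) := by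
        rw [Nat.cast_sub (by omega), Nat.cast_sub (by omega)]
        exact congrArg (· - (N : ZMod N)) hxy
      have h' := ZMod.natCast_injOn_Icc N (x₁ := x - N) (x₂ := y - N)
        (by rw [mem_coe, mem_Icc]; omega) (by rw [mem_coe, mem_Icc]; omega) h
      omega
  have hsplit := card_filter_add_card_filter_not (s := A + B) (fun x => x ≤ N)
  omega

open Classical in
/-- Sets `S` and `M` such that `S + M` avoids `I` modulo `N`, and `I + M` avoids `I + N`. -/
theorem card_add_card_le_of_add_avoids {N : ℕ} {I S M : Finset ℕ} (hI : I ⊆ Icc 1 N)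
    (hone : 1 ∈ I) (hM : M ⊆ Icc 1 (N - 1)) (hSI : S ⊆ I) (hN : N ∈ S) (hMne : M.Nonempty)
    (hW : ∀ i ∈ I, ∀ j ∈ I, ∀ m ∈ M, i + m ≠ j + N) (hS : ∀ s ∈ S, ∀ m ∈ M, s + m ∉ I) :
    #S + #M + #I ≤ N + 1 ∨ 2 * #M + 3 * #I ≤ 2 * N := by
  obtain ⟨m₀, hm₀⟩ := hMne
  have hm₀' := mem_Icc.1 (hM hm₀)
  have : NeZero N := ⟨by omega⟩
  have hMN : M ⊆ Icc 1 N := hM.trans (Icc_subset_Icc_right (Nat.sub_le _ _))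
  have hcard : ∀ s ⊆ Icc 1 N, #(s.image fun i : ℕ => (i : ZMod N)) = #s := fun s hs =>
    card_image_of_injOn ((ZMod.natCast_injOn_Icc N).mono fun x hx => hs hx)
  set I' := I.image fun i : ℕ => (i : ZMod N) with hI'
  set S' := S.image fun i : ℕ => (i : ZMod N) with hS'
  set M' := M.image fun i : ℕ => (i : ZMod N) with hM'
  have hIcard : #I' = #I := hcard I hI
  have hScard : #S' = #S := hcard S (hSI.trans hI)
  have hMcard : #M' = #M := hcard M hMN
  have hM'ne : M'.Nonempty := ⟨_, mem_image_of_mem _ hm₀⟩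
  set C := S' + M' with hC
  have hCI : ∀ x ∈ I', x ∉ C := by
    intro x hx hxC
    obtain ⟨i, hi, rfl⟩ := mem_image.1 hx
    obtain ⟨s', hs', m', hm', hsm⟩ := mem_add.1 hxC
    obtain ⟨s, hs, rfl⟩ := mem_image.1 hs'
    obtain ⟨m, hm, rfl⟩ := mem_image.1 hm'
    have h₁ := mem_Icc.1 (hI hi)
    have h₂ := mem_Icc.1 (hI (hSI hs))
    have h₃ := mem_Icc.1 (hMN hm)
    rcases ZMod.natCast_eq_natCast_of_le_two_mul (a := s + m) (by omega) (by omega) h₁.1 h₁.2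
      (by push_cast; exact hsm) with h | h
    · exact hS s hs m hm (h ▸ hi)
    · exact hW s (hSI hs) i hi m hm h
  have hzero : (0 : ZMod N) ∈ S' := mem_image.2 ⟨N, hN, by simp⟩
  have hS'I' : S' ⊆ I' := image_subset_image hSI
  set A : Finset (ZMod N) := univ.filter fun x => ∀ m ∈ M', x + m ∈ C with hA
  have hSA : S' ⊆ A := fun x hx => mem_filter.2 ⟨mem_univ _, fun m hm => add_mem_add hx hm⟩
  have hAM : A + M' = C := by
    refine subset_antisymm (fun x hx => ?_) (add_subset_add_right hSA)
    obtain ⟨a, ha, m, hm, rfl⟩ := mem_add.1 hx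
    exact (mem_filter.1 ha).2 m hm
  obtain ⟨K, hK, hKcard⟩ := kneser_add_cosets (A := A) hM'ne
  rw [hAM] at hK hKcard
  by_contra! hcon
  obtain ⟨hcon₁, hcon₂⟩ := hcon
  set MK := M'.biUnion (cosetFinset K) with hMK
  have hMMK : M' ⊆ MK := fun x hx => mem_biUnion.2 ⟨x, hx, mem_cosetFinset.2 (by simp)⟩
  have hSAcard := card_le_card hSA
  have hMMKcard := card_le_card hMMK
  have hTcard : #Cᶜ + #C = N := by rw [card_compl_add_card, ZMod.card]
  have hIT : I' ⊆ Cᶜ := fun x hx => mem_compl.2 (hCI x hx)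
  have hTIcard := card_sdiff_add_card_eq_card hIT
  have hcoset : ∀ x ∉ C, cosetFinset K x ⊆ Cᶜ := fun x hx y hy =>
    mem_compl.2 (disjoint_left.1 (hK.disjoint_cosetFinset hx) hy)
  have hTA : Cᶜ ⊆ A := by
    intro c hc
    rw [mem_compl] at hc
    refine mem_filter.2 ⟨mem_univ _, fun m hm => ?_⟩
    by_contra hcm
    have hmK : m ∉ K := fun hmK => hCI 0 (hS'I' hzero) <|
      (hK.add_mem_iff hmK).1 (add_mem_add hzero hm)
    have hdisj : Disjoint (cosetFinset K c \ I') (cosetFinset K (c + m) \ I') := by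
      refine disjoint_left.2 fun x hx hx' => hmK ?_
      rw [mem_sdiff, mem_cosetFinset] at hx hx'
      convert K.sub_mem hx.1 hx'.1 using 1
      abel
    have h₁ : #(cosetFinset K c \ I') + #(cosetFinset K (c + m) \ I') ≤ #(Cᶜ \ I') := by
      rw [← card_union_of_disjoint hdisj]
      exact card_le_card (union_subset (sdiff_subset_sdiff (hcoset c hc) subset_rfl)
        (sdiff_subset_sdiff (hcoset _ hcm) subset_rfl))
    have h₂ : #(cosetFinset K m \ M') + #M' ≤ #MK := by
      rw [← card_sdiff_add_card_eq_card hMMK]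
      refine Nat.add_le_add_right (card_le_card (sdiff_subset_sdiff (fun x hx => ?_) subset_rfl)) _
      exact mem_biUnion.2 ⟨m, hm, hx⟩
    have h₃ := card_inter_add_card_sdiff (cosetFinset K c) I'
    have h₄ := card_inter_add_card_sdiff (cosetFinset K m) M'
    rw [card_cosetFinset] at h₃ h₄
    have hp₁ : 0 < #(cosetFinset K c ∩ I') := by omega
    have hp₂ : 0 < #(cosetFinset K m ∩ M') := by omega
    have h₅ := card_coset_add_le hI hMN hW K c m (card_pos.1 hp₁) (card_pos.1 hp₂)
    rw [← hI', ← hM'] at h₅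
    omega
  have hTAcard := card_le_card hTA
  have honeK : (1 : ZMod N) ∉ K := by
    intro h
    have hx : (0 : ZMod N) + ((m₀ : ℕ) : ZMod N) ∈ C := add_mem_add hzero (mem_image_of_mem _ hm₀)
    refine hCI 0 (hS'I' hzero) ((hK.add_mem_iff ?_).1 hx)
    simpa using K.nsmul_mem h m₀
  have htwo : 2 * Nat.card K ≤ #Cᶜ := by
    have hdisj : Disjoint (cosetFinset K (0 : ZMod N)) (cosetFinset K 1) := by
      refine disjoint_left.2 fun x hx hx' => honeK ?_
      rw [mem_cosetFinset] at hx hx'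
      convert K.sub_mem hx hx' using 1
      abel
    have h := card_le_card (union_subset (hcoset 0 (hCI 0 (hS'I' hzero)))
      (hcoset 1 (hCI 1 (mem_image.2 ⟨1, hone, by simp⟩))))
    rw [card_union_of_disjoint hdisj, card_cosetFinset, card_cosetFinset] at h
    omega
  have hITcard := card_le_card hIT
  omega

end Core

section Reflection
open Finset

/-- The mirror image of `card_add_card_le_of_add_avoids` under `i ↦ N + 1 - i`. -/
theorem card_add_card_le_of_sub_avoids {N : ℕ} {I S M : Finset ℕ} (hI : I ⊆ Icc 1 N)
    (hNI : N ∈ I) (hM : M ⊆ Icc 1 (N - 1)) (hSI : S ⊆ I) (hone : 1 ∈ S) (hMne : M.Nonempty)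
    (hW : ∀ i ∈ I, ∀ j ∈ I, ∀ m ∈ M, i + m ≠ j + N) (hS : ∀ i ∈ I, ∀ m ∈ M, i + m ∉ S) :
    #S + #M + #I ≤ N + 1 ∨ 2 * #M + 3 * #I ≤ 2 * N := by
  have hIcc : ∀ i ∈ I, 1 ≤ i ∧ i ≤ N := fun i hi => mem_Icc.1 (hI hi)
  have hcard : ∀ s ⊆ I, #(s.image (N + 1 - ·)) = #s := fun s hs =>
    card_image_of_injOn fun x hx y hy (hxy : N + 1 - x = N + 1 - y) => by
      have := hIcc x (hs hx)
      have := hIcc y (hs hy)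
      omega
  rw [← hcard S hSI, ← hcard I subset_rfl]
  refine card_add_card_le_of_add_avoids ?_ (mem_image.2 ⟨N, hNI, by omega⟩) hM
    (image_subset_image hSI) (mem_image.2 ⟨1, hone, by omega⟩) hMne ?_ ?_
  · intro x hx
    obtain ⟨i, hi, rfl⟩ := mem_image.1 hx
    have := hIcc i hi
    exact mem_Icc.2 (by omega)
  · intro x hx y hy m hm h
    obtain ⟨i, hi, rfl⟩ := mem_image.1 hx
    obtain ⟨j, hj, rfl⟩ := mem_image.1 hy
    have := hIcc i hi
    have := hIcc j hj
    exact hW j hj i hi m hm (by omega)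
  · intro x hx m hm h
    obtain ⟨s, hs, rfl⟩ := mem_image.1 hx
    obtain ⟨i, hi, hsi⟩ := mem_image.1 h
    have := hIcc s (hSI hs)
    have := hIcc i hi
    exact hS i hi m hm ((show i + m = s by omega) ▸ hs)

open Classical in
/-- A bound for the number of missing cycle lengths, in terms of the positions `I` of the
neighbours of a vertex along a Hamiltonian cycle. -/
theorem two_mul_card_add_three_mul_card_le {N : ℕ} {adj : ℕ → ℕ → Prop} {I M : Finset ℕ}
    (hI : I ⊆ Icc 1 N) (hone : 1 ∈ I) (hN : N ∈ I) (hM : M ⊆ Icc 1 (N - 1)) (hMne : M.Nonempty)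
    (hW : ∀ i ∈ I, ∀ j ∈ I, ∀ m ∈ M, i + m ≠ j + N)
    (hE : ∀ b ∈ I, ∀ m ∈ M, b + m ∈ I → ¬ adj 1 N ∧ ¬ adj 1 (b + m) ∧ ¬ adj b N)
    (hclaw : ∀ x ∈ I, x ≠ 1 → x ≠ N → adj 1 N ∨ adj 1 x ∨ adj x N) :
    2 * #M + 3 * #I ≤ 2 * N + 2 := by
  have hIcc : ∀ i ∈ I, 1 ≤ i ∧ i ≤ N := fun i hi => mem_Icc.1 (hI hi)
  have hMpos : ∀ m ∈ M, 1 ≤ m := fun m hm => (mem_Icc.1 (hM hm)).1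
  by_cases hadj : adj 1 N
  · have := card_add_card_le_of_add_avoids hI hone hM subset_rfl hN hMne hW
      fun s hs m hm h => (hE s hs m hm h).1 hadj
    omega
  set P := I.filter fun x => ¬ (x = N ∨ adj x N) with hP
  set Q := I.filter fun x => ¬ (x = 1 ∨ adj 1 x) with hQ
  have hPI : P ⊆ I := filter_subset _ _
  have hQI : Q ⊆ I := filter_subset _ _
  have hPQ : #P + #Q ≤ #I := by
    rw [← card_union_of_disjoint]
    · exact card_le_card (union_subset hPI hQI)
    · refine disjoint_left.2 fun x hx hx' => ?_
      obtain ⟨hxI, hxP⟩ := mem_filter.1 hx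
      obtain ⟨-, hxQ⟩ := mem_filter.1 hx'
      have := hclaw x hxI
      tauto
  have hPcard := card_sdiff_add_card_eq_card hPI
  have hQcard := card_sdiff_add_card_eq_card hQI
  rcases le_total #P #Q with hle | hle
  · have := card_add_card_le_of_add_avoids hI hone hM (S := I \ P) sdiff_subset
      (mem_sdiff.2 ⟨hN, by simp [hP]⟩) hMne hW fun s hs m hm h => by
        obtain ⟨hsI, hsP⟩ := mem_sdiff.1 hs
        refine hsP (mem_filter.2 ⟨hsI, ?_⟩)
        rintro (rfl | h')
        · have := hIcc _ h
          have := hMpos m hm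
          omega
        · exact (hE s hsI m hm h).2.2 h'
    omega
  · have := card_add_card_le_of_sub_avoids hI hN hM (S := I \ Q) sdiff_subset
      (mem_sdiff.2 ⟨hone, by simp [hQ]⟩) hMne hW fun i hi m hm h => by
        obtain ⟨hsI, hsQ⟩ := mem_sdiff.1 h
        refine hsQ (mem_filter.2 ⟨hsI, ?_⟩)
        rintro (h' | h')
        · have := hIcc i hi
          have := hMpos m hm
          omega
        · exact (hE i hi m hm hsI).2.1 h'
    omega

end Reflection

section Cycles
open Finset

/-- An injective closed sequence of consecutively adjacent vertices is a cycle. -/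
theorem hasCycleLength_of_injOn {V : Type*} {G : SimpleGraph V} {ℓ : ℕ} (hℓ : 3 ≤ ℓ) {g : ℕ → V}
    (hinj : Set.InjOn g (Set.Iio ℓ)) (hadj : ∀ t, t + 1 < ℓ → G.Adj (g t) (g (t + 1)))
    (hclose : G.Adj (g (ℓ - 1)) (g 0)) : HasCycleLength G ℓ := by
  refine (SimpleGraph.cycleGraph_isContained_iff hℓ).1 ⟨⟨⟨fun i => g i, ?_⟩, ?_⟩⟩
  · rintro ⟨x, hx⟩ ⟨y, hy⟩ hxy
    have hne : x ≠ y := fun h => hxy.ne (Fin.ext h)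
    wlog hlt : y < x generalizing x y
    · exact (this y hy x hx hxy.symm hne.symm (by omega)).symm
    rcases SimpleGraph.cycleGraph_adj'.1 hxy with h | h
    · rw [Fin.sub_val_of_le (Fin.mk_le_mk.2 hlt.le)] at h
      obtain rfl : x = y + 1 := by simp only at h; omega
      exact (hadj y hx).symm
    · rw [Fin.coe_sub_iff_lt.2 (Fin.mk_lt_mk.2 hlt)] at h
      simp only at h
      obtain ⟨rfl, rfl⟩ : x = ℓ - 1 ∧ y = 0 := by omega
      exact hclose
  · intro x y hxy
    exact Fin.ext (hinj x.2 y.2 hxy)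

variable {V : Type*} {G : SimpleGraph V} {N : ℕ} {f : ℕ → V}

/-- `hasCycleLength_of_injOn` for a rearrangement `h` of part of a path `f`. -/
theorem hasCycleLength_of_index_injOn (hinj : Set.InjOn f (Set.Iic N)) {ℓ : ℕ} (hℓ : 3 ≤ ℓ)
    (h : ℕ → ℕ) (hle : ∀ t < ℓ, h t ≤ N) (hh : Set.InjOn h (Set.Iio ℓ))
    (hadj : ∀ t, t + 1 < ℓ → G.Adj (f (h t)) (f (h (t + 1))))
    {x : ℕ} (hfirst : h 0 = 0) (hlast : h (ℓ - 1) = x) (hclose : G.Adj (f 0) (f x)) :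
    HasCycleLength G ℓ :=
  hasCycleLength_of_injOn (g := f ∘ h) hℓ (hinj.comp hh fun t ht => hle t ht) hadj
    (by simpa [hfirst, hlast] using hclose.symm)

theorem adj_of_consecutive (hstep : ∀ i < N, G.Adj (f i) (f (i + 1))) {x y : ℕ} (hx : x ≤ N)
    (hy : y ≤ N) (hxy : x + 1 = y ∨ y + 1 = x) : G.Adj (f x) (f y) := by
  rcases hxy with rfl | rfl
  · exact hstep x (by omega)
  · exact (hstep y (by omega)).symm

/-- The cycle through `f 0` and the segment from `f j` to `f i`. -/
theorem hasCycleLength_of_segment (hinj : Set.InjOn f (Set.Iic N))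
    (hstep : ∀ i < N, G.Adj (f i) (f (i + 1))) {i j : ℕ} (hj : 1 ≤ j) (hij : j < i) (hi : i ≤ N)
    (hfi : G.Adj (f 0) (f i)) (hfj : G.Adj (f 0) (f j)) : HasCycleLength G (i - j + 2) := by
  refine hasCycleLength_of_index_injOn hinj (by omega) (fun t => if t < 1 then 0 else j + t - 1)
    (fun t ht => ?_) (fun s hs t ht hst => ?_) (fun t ht => ?_) (by simp) ?_ hfi
  · split_ifs <;> omega
  · simp only [Set.mem_Iio] at hs ht hst
    split_ifs at hst <;> omega
  · rcases Nat.eq_zero_or_pos t with rfl | h₀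
    · simpa using hfj
    · refine adj_of_consecutive hstep ?_ ?_ ?_ <;> split_ifs <;> omega
  · split_ifs <;> omega

/-- The cycle through `f 0`, the segment from `f b` down to `f 1`, and the segment from `f c` up to
`f N`. -/
theorem hasCycleLength_of_adj_one (hinj : Set.InjOn f (Set.Iic N))
    (hstep : ∀ i < N, G.Adj (f i) (f (i + 1))) {b c : ℕ} (hb : 1 ≤ b) (hbc : b < c) (hc : c ≤ N)
    (hfb : G.Adj (f 0) (f b)) (hfN : G.Adj (f 0) (f N)) (h : G.Adj (f 1) (f c)) :
    HasCycleLength G (N - (c - b) + 2) := by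
  refine hasCycleLength_of_index_injOn hinj (by omega)
    (fun t => if t < 1 then 0 else if t ≤ b then b + 1 - t else t - b - 1 + c)
    (fun t ht => ?_) (fun s hs t ht hst => ?_) (fun t ht => ?_) (by simp) ?_ hfN
  · split_ifs <;> omega
  · simp only [Set.mem_Iio] at hs ht hst
    split_ifs at hst <;> omega
  · rcases Nat.eq_zero_or_pos t with rfl | h₀
    · simpa [hb] using hfb
    rcases eq_or_ne t b with rfl | h₁
    · simpa [h₀.ne'] using h
    · refine adj_of_consecutive hstep ?_ ?_ ?_ <;> split_ifs <;> omega
  · split_ifs <;> omega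

/-- The cycle through `f 0`, the segment from `f 1` up to `f b`, and the segment from `f N` down to
`f c`. -/
theorem hasCycleLength_of_adj_last (hinj : Set.InjOn f (Set.Iic N))
    (hstep : ∀ i < N, G.Adj (f i) (f (i + 1))) {b c : ℕ} (hb : 1 ≤ b) (hbc : b < c) (hc : c ≤ N)
    (hfc : G.Adj (f 0) (f c)) (h : G.Adj (f b) (f N)) :
    HasCycleLength G (N - (c - b) + 2) := by
  refine hasCycleLength_of_index_injOn hinj (by omega)
    (fun t => if t ≤ b then t else N - (t - b - 1))
    (fun t ht => ?_) (fun s hs t ht hst => ?_) (fun t ht => ?_) (by simp) ?_ hfc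
  · split_ifs <;> omega
  · simp only [Set.mem_Iio] at hs ht hst
    split_ifs at hst <;> omega
  · rcases eq_or_ne t b with rfl | h₁
    · simpa using h
    · refine adj_of_consecutive hstep ?_ ?_ ?_ <;> split_ifs <;> omega
  · split_ifs <;> omega

/-- The cycle through `f 0`, the segment from `f b` down to `f 1`, and the segment from `f N` down
to `f c`. -/
theorem hasCycleLength_of_adj_one_last (hinj : Set.InjOn f (Set.Iic N))
    (hstep : ∀ i < N, G.Adj (f i) (f (i + 1))) {b c : ℕ} (hb : 1 ≤ b) (hbc : b < c) (hc : c ≤ N)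
    (hfb : G.Adj (f 0) (f b)) (hfc : G.Adj (f 0) (f c)) (h : G.Adj (f 1) (f N)) :
    HasCycleLength G (N - (c - b) + 2) := by
  refine hasCycleLength_of_index_injOn hinj (by omega)
    (fun t => if t < 1 then 0 else if t ≤ b then b + 1 - t else N - (t - b - 1))
    (fun t ht => ?_) (fun s hs t ht hst => ?_) (fun t ht => ?_) (by simp) ?_ hfc
  · split_ifs <;> omega
  · simp only [Set.mem_Iio] at hs ht hst
    split_ifs at hst <;> omega
  · rcases Nat.eq_zero_or_pos t with rfl | h₀
    · simpa [hb] using hfb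
    rcases eq_or_ne t b with rfl | h₁
    · simpa [h₀.ne'] using h
    · refine adj_of_consecutive hstep ?_ ?_ ?_ <;> split_ifs <;> omega
  · split_ifs <;> omega

end Cycles

section Spectrum
open Finset

theorem finite_setOf_hasCycleLength {V : Type*} [Finite V] (G : SimpleGraph V) :
    {ℓ : ℕ | HasCycleLength G ℓ}.Finite := by
  have := Fintype.ofFinite V
  refine (Set.finite_Iic (Fintype.card V)).subset ?_
  rintro ℓ ⟨v, w, hw, rfl⟩
  have := hw.support_nodup.length_le_card
  simpa using this

open Classical in
/-- The number of cycle lengths, in terms of the number of neighbours on a cycle `f` of its first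
vertex. -/
theorem le_ncard_setOf_hasCycleLength {V : Type*} [Finite V] {G : SimpleGraph V}
    (hG : ClawFree G) {N : ℕ} {f : ℕ → V} (hinj : Set.InjOn f (Set.Iic N))
    (hstep : ∀ i < N, G.Adj (f i) (f (i + 1))) (hclose : G.Adj (f 0) (f N)) (hN : 2 ≤ N) :
    min (N + 1) ((3 * #{i ∈ Icc 1 N | G.Adj (f 0) (f i)} + 1) / 2) - 2 ≤
      {ℓ : ℕ | HasCycleLength G ℓ}.ncard := by
  set I : Finset ℕ := {i ∈ Icc 1 N | G.Adj (f 0) (f i)} with hI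
  set M : Finset ℕ := {m ∈ Icc 1 (N - 1) | ¬ HasCycleLength G (N - m + 2)} with hM
  have hIdef : ∀ i ∈ I, (1 ≤ i ∧ i ≤ N) ∧ G.Adj (f 0) (f i) := fun i hi => by
    simpa [hI] using hi
  have hMdef : ∀ m ∈ M, (1 ≤ m ∧ m ≤ N - 1) ∧ ¬ HasCycleLength G (N - m + 2) := fun m hm => by
    simpa [hM] using hm
  have hone : 1 ∈ I := mem_filter.2 ⟨mem_Icc.2 (by omega), hstep 0 (by omega)⟩
  have hNI : N ∈ I := mem_filter.2 ⟨mem_Icc.2 (by omega), hclose⟩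
  have hcount : N - 1 ≤ #M + {ℓ : ℕ | HasCycleLength G ℓ}.ncard := by
    have hsplit : #{m ∈ Icc 1 (N - 1) | HasCycleLength G (N - m + 2)} + #M = #(Icc 1 (N - 1)) := by
      convert card_filter_add_card_filter_not (s := Icc 1 (N - 1))
        (fun m => HasCycleLength G (N - m + 2))
    have hle : #{m ∈ Icc 1 (N - 1) | HasCycleLength G (N - m + 2)} ≤
        {ℓ : ℕ | HasCycleLength G ℓ}.ncard := by
      rw [← Set.ncard_coe_finset]
      refine Set.ncard_le_ncard_of_injOn (fun m => N - m + 2) (fun m hm => ?_)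
        (fun a ha b hb hab => ?_) (finite_setOf_hasCycleLength G)
      · exact (mem_filter.1 (mem_coe.1 hm)).2
      · simp only [coe_filter, mem_Icc, Set.mem_ofPred_eq] at ha hb hab
        omega
    rw [Nat.card_Icc] at hsplit
    omega
  rcases M.eq_empty_or_nonempty with hMe | hMne
  · rw [hMe, card_empty] at hcount
    omega
  have hmain := two_mul_card_add_three_mul_card_le (adj := fun i j => G.Adj (f i) (f j))
    (filter_subset _ _) hone hNI (filter_subset _ _) hMne (I := I) (M := M) ?_ ?_ ?_
  · omega
  · intro i hi j hj m hm hij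
    obtain ⟨hi₁, hi₂⟩ := hIdef i hi
    obtain ⟨hj₁, hj₂⟩ := hIdef j hj
    obtain ⟨hm₁, hm₂⟩ := hMdef m hm
    refine hm₂ ?_
    rw [show N - m = i - j by omega]
    exact hasCycleLength_of_segment hinj hstep hj₁.1 (by omega) hi₁.2 hi₂ hj₂
  · intro b hb m hm hbm
    obtain ⟨hb₁, hb₂⟩ := hIdef b hb
    obtain ⟨hc₁, hc₂⟩ := hIdef (b + m) hbm
    obtain ⟨hm₁, hm₂⟩ := hMdef m hm
    rw [show m = b + m - b by omega] at hm₂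
    have hlt : b < b + m := by omega
    exact ⟨fun h => hm₂ (hasCycleLength_of_adj_one_last hinj hstep hb₁.1 hlt hc₁.2 hb₂ hc₂ h),
      fun h => hm₂ (hasCycleLength_of_adj_one hinj hstep hb₁.1 hlt hc₁.2 hb₂ hclose h),
      fun h => hm₂ (hasCycleLength_of_adj_last hinj hstep hb₁.1 hlt hc₁.2 hc₂ h)⟩
  · intro x hx hx₁ hxN
    obtain ⟨hx₂, hx₃⟩ := hIdef x hx
    have hne : ∀ i ≤ N, ∀ j ≤ N, i ≠ j → f i ≠ f j := fun i hi j hj hij h => hij (hinj hi hj h)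
    by_contra! hcon
    exact hG (f 0) (f 1) (f N) (f x) (hIdef 1 hone).2 hclose hx₃
      (hne _ (by omega) _ (by omega) (by omega)) (hne _ (by omega) _ (by omega) (by omega))
      (hne _ (by omega) _ (by omega) (by omega)) hcon.1 hcon.2.1 fun h => hcon.2.2 h.symm

end Spectrum

/-- If `G` is a claw-free hamiltonian graph of order `n` and maximum degree `Δ ≥ 24`,
then `G` has cycles of at least `min {n, ⌈(3/2)Δ⌉} - 2` many different lengths.
(Note `⌈(3/2)Δ⌉ = (3 * Δ + 1) / 2` in natural number arithmetic.) -/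
theorem cycle_spectrum_claw_free_hamiltonian {V : Type*} [Fintype V] [DecidableEq V]
    (G : SimpleGraph V) [DecidableRel G.Adj] (n Δ : ℕ)
    (hn : n = Fintype.card V) (hΔ : Δ = G.maxDegree)
    (hclaw : ClawFree G)
    (hham : ∃ (v : V) (w : G.Walk v v), w.IsCycle ∧ ∀ x : V, x ∈ w.support)
    (hΔ24 : 24 ≤ Δ) :
    min n ((3 * Δ + 1) / 2) - 2 ≤ {ℓ : ℕ | HasCycleLength G ℓ}.ncard := by
  obtain ⟨v, p, hp, hsupp⟩ := hham
  have : Nonempty V := ⟨v⟩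
  obtain ⟨u, hu⟩ := G.exists_maximal_degree_vertex
  obtain ⟨w, hw, hwsupp, hlen⟩ : ∃ w : G.Walk u u, w.IsCycle ∧ (∀ x, x ∈ w.support) ∧
      w.length = p.length :=
    ⟨p.rotate u (hsupp u), hp.rotate (hsupp u), fun x => by simp [hsupp x], by simp⟩
  have hthree := hw.three_le_length
  have hinj : Set.InjOn w.getVert (Set.Iic (w.length - 1)) := hw.getVert_injOn'
  have hclose : G.Adj (w.getVert 0) (w.getVert (w.length - 1)) := by
    have h := w.adj_getVert_succ (i := w.length - 1) (by omega)
    rw [show w.length - 1 + 1 = w.length by omega, w.getVert_length] at h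
    simpa using h.symm
  have hsurj : ∀ x, ∃ i ≤ w.length - 1, w.getVert i = x := by
    intro x
    obtain ⟨i, rfl, hi⟩ := SimpleGraph.Walk.mem_support_iff_exists_getVert.1 (hwsupp x)
    rcases hi.lt_or_eq with hlt | rfl
    · exact ⟨i, by omega, rfl⟩
    · exact ⟨0, by omega, by simp⟩
  have hcard : w.length = n := by
    have h : (Finset.range w.length).image w.getVert = Finset.univ := by
      ext x
      obtain ⟨i, hi, hix⟩ := hsurj x
      simpa using ⟨i, by omega, hix⟩
    rw [hn, ← Finset.card_univ, ← h, Finset.card_image_of_injOn, Finset.card_range]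
    exact hinj.mono fun i hi => by
      rw [Finset.mem_coe, Finset.mem_range] at hi
      exact Set.mem_Iic.2 (by omega)
  have hdeg : ((Finset.Icc 1 (w.length - 1)).filter fun i =>
      G.Adj (w.getVert 0) (w.getVert i)).card = Δ := by
    have h : ((Finset.Icc 1 (w.length - 1)).filter fun i =>
        G.Adj (w.getVert 0) (w.getVert i)).image w.getVert = G.neighborFinset u := by
      ext x
      simp only [Finset.mem_image, Finset.mem_filter, Finset.mem_Icc, w.getVert_zero,
        SimpleGraph.mem_neighborFinset]
      constructor
      · rintro ⟨i, ⟨-, hi⟩, rfl⟩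
        exact hi
      · intro hx
        obtain ⟨i, hi, rfl⟩ := hsurj x
        refine ⟨i, ⟨⟨Nat.one_le_iff_ne_zero.2 ?_, hi⟩, hx⟩, rfl⟩
        rintro rfl
        exact hx.ne w.getVert_zero.symm
    rw [hΔ, hu, ← SimpleGraph.card_neighborFinset_eq_degree, ← h, Finset.card_image_of_injOn]
    exact hinj.mono fun i hi => by
      rw [Finset.mem_coe, Finset.mem_filter, Finset.mem_Icc] at hi
      exact hi.1.2
  have hmain := le_ncard_setOf_hasCycleLength hclaw hinj
    (fun i hi => w.adj_getVert_succ (by omega)) hclose (by omega)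
  rw [show w.length - 1 + 1 = n by omega] at hmain
  rw [← hdeg]
  convert hmain
end

section
/- Let G be a graph of order n that contains a cycle C of length n − 1, and suppose the unique vertex u of G not lying on C has degree strictly greater than (n − 1)/2. Then G is pancyclic, i.e., G has cycles of every length ℓ with 3 ≤ ℓ ≤ n. -/
namespace SimpleGraph

variable {V : Type*} {G : SimpleGraph V}

/-- A sequence of consecutively adjacent vertices that is injective on `{i, …, i + k}` gives a
path through exactly these vertices. -/
theorem exists_isPath_of_adj_succ {c : ℕ → V} (hadj : ∀ i, G.Adj (c i) (c (i + 1))) (i k : ℕ)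
    (hinj : Set.InjOn c (Set.Icc i (i + k))) :
    ∃ p : G.Walk (c i) (c (i + k)), p.IsPath ∧ p.length = k ∧
      ∀ x ∈ p.support, ∃ j ∈ Set.Icc i (i + k), c j = x := by
  induction k with
  | zero => exact ⟨.nil, by simp, rfl, by simp⟩
  | succ k ih =>
    obtain ⟨p, hp, hlen, hsupp⟩ := ih (hinj.mono (Set.Icc_subset_Icc_right (by omega)))
    refine ⟨p.concat (hadj (i + k)), hp.concat ?_ _, by simp [hlen], ?_⟩
    · intro hmem
      obtain ⟨j, hj, hcj⟩ := hsupp _ hmem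
      rw [Set.mem_Icc] at hj
      have := hinj (Set.mem_Icc.2 ⟨hj.1, by omega⟩) (Set.mem_Icc.2 ⟨by omega, by omega⟩) hcj
      omega
    · intro x hx
      rw [Walk.support_concat, List.mem_append, List.mem_singleton] at hx
      rcases hx with hx | rfl
      · obtain ⟨j, hj, hcj⟩ := hsupp _ hx
        exact ⟨j, Set.Icc_subset_Icc_right (by omega) hj, hcj⟩
      · exact ⟨i + (k + 1), Set.mem_Icc.2 ⟨by omega, le_rfl⟩, rfl⟩

/-- Closing a path through a common neighbour `u` of its two distinct ends gives a cycle. -/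
theorem Walk.IsPath.hasCycleLength {u a b : V} {p : G.Walk a b} (hp : p.IsPath)
    (hab : a ≠ b) (hu : u ∉ p.support) (ha : G.Adj u a) (hb : G.Adj u b) :
    HasCycleLength G (p.length + 2) := by
  refine ⟨u, .cons ha (p.concat hb.symm), ?_, by simp⟩
  rw [Walk.cons_isCycle_iff]
  refine ⟨hp.concat hu _, ?_⟩
  rw [Walk.edges_concat, List.concat_eq_append, List.mem_append, List.mem_singleton]
  rintro (h | h)
  · exact hu (p.fst_mem_support_of_mem_edges h)
  · rw [Sym2.eq_swap, Sym2.eq_iff] at h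
    rcases h with h | h
    · exact hab h.1
    · exact ha.ne h.1.symm

end SimpleGraph

/-- Two elements of a set of more than half of the residues modulo `m` differ by a given `k`. -/
theorem Finset.exists_add_mod_mem {m k : ℕ} {S : Finset ℕ} (hS : S ⊆ Finset.range m)
    (hcard : m < 2 * S.card) : ∃ i ∈ S, (i + k) % m ∈ S := by
  by_contra! h
  have hm : 0 < m := by
    by_contra hm
    obtain rfl : m = 0 := by omega
    simp_all
  have hinj : Set.InjOn (fun i => (i + k) % m) S := by
    intro a ha b hb hab
    have hmod : a ≡ b [MOD m] := Nat.ModEq.add_right_cancel' k hab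
    exact hmod.eq_of_lt_of_lt (Finset.mem_range.1 (hS ha)) (Finset.mem_range.1 (hS hb))
  have hdisj : Disjoint S (S.image fun i => (i + k) % m) := by
    rw [Finset.disjoint_right]
    intro x hx
    obtain ⟨i, hi, rfl⟩ := Finset.mem_image.1 hx
    exact h i hi
  have hsub : S ∪ S.image (fun i => (i + k) % m) ⊆ Finset.range m := by
    refine Finset.union_subset hS fun x hx => ?_
    obtain ⟨i, -, rfl⟩ := Finset.mem_image.1 hx
    exact Finset.mem_range.2 (Nat.mod_lt _ hm)
  have := Finset.card_le_card hsub
  rw [Finset.card_union_of_disjoint hdisj, Finset.card_image_of_injOn hinj,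
    Finset.card_range] at this
  omega

/-- If `G` is a graph of order `n` with a cycle of length `n - 1` and the vertex `u` that
does not lie on this cycle has degree strictly greater than `(n-1)/2`, then `G` is pancyclic. -/
theorem pancyclic_of_cycle_length_sub_one {V : Type*} [Fintype V] [DecidableEq V]
    (G : SimpleGraph V) [DecidableRel G.Adj] (n : ℕ) (hn : n = Fintype.card V)
    (v u : V) (w : G.Walk v v) (hw : w.IsCycle) (hlen : w.length = n - 1)
    (hu : u ∉ w.support) (hdeg : n - 1 < 2 * G.degree u) :
    ∀ ℓ : ℕ, 3 ≤ ℓ → ℓ ≤ n → HasCycleLength G ℓ := by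
  intro ℓ h3 hℓ
  set m := w.length with hm
  have hm3 : 3 ≤ m := hw.three_le_length
  let c : ℕ → V := fun i => w.getVert (i % m)
  have hcu (i : ℕ) : c i ≠ u := fun h => hu (h ▸ w.getVert_mem_support _)
  have hcinj {i j : ℕ} (h : c i = c j) : i ≡ j [MOD m] :=
    hw.getVert_injOn' (Nat.le_sub_one_of_lt (Nat.mod_lt i (by omega)))
      (Nat.le_sub_one_of_lt (Nat.mod_lt j (by omega))) h
  have hadj (i : ℕ) : G.Adj (c i) (c (i + 1)) := by
    have hlt : i % m < m := Nat.mod_lt i (by omega)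
    have hstep := w.adj_getVert_succ hlt
    have hc : c (i + 1) = w.getVert (i % m + 1) := by
      change w.getVert ((i + 1) % m) = _
      rw [← Nat.mod_add_mod]
      rcases Nat.lt_or_ge (i % m + 1) m with h | h
      · rw [Nat.mod_eq_of_lt h]
      · rw [show i % m + 1 = m by omega, Nat.mod_self, hm, w.getVert_length, w.getVert_zero]
    rw [hc]
    exact hstep
  have himage : (Finset.range m).image c = Finset.univ.erase u := by
    refine Finset.eq_of_subset_of_card_le (fun x hx => ?_) ?_
    · obtain ⟨i, -, rfl⟩ := Finset.mem_image.1 hx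
      simpa using hcu i
    · rw [Finset.card_image_of_injOn, Finset.card_erase_of_mem (Finset.mem_univ u),
        Finset.card_univ, Finset.card_range]
      · omega
      · intro i hi j hj h
        exact (hcinj h).eq_of_lt_of_lt (by simpa using hi) (by simpa using hj)
  let S := (Finset.range m).filter fun i => G.Adj u (c i)
  have hScard : G.degree u ≤ S.card := by
    refine le_trans (Finset.card_le_card fun x hx => ?_) (Finset.card_image_le (f := c))
    rw [SimpleGraph.mem_neighborFinset] at hx
    have hmem : x ∈ (Finset.range m).image c := by simp [himage, hx.ne']
    obtain ⟨i, hi, rfl⟩ := Finset.mem_image.1 hmem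
    exact Finset.mem_image_of_mem c (Finset.mem_filter.2 ⟨hi, hx⟩)
  obtain ⟨i, hi, hik⟩ := Finset.exists_add_mod_mem (k := ℓ - 2) (Finset.filter_subset _ _)
    (show m < 2 * S.card by omega)
  have hai : G.Adj u (c i) := (Finset.mem_filter.1 hi).2
  have hak : G.Adj u (c (i + (ℓ - 2))) := by
    have h := (Finset.mem_filter.1 hik).2
    simpa only [c, Nat.mod_mod] using h
  have hinj : Set.InjOn c (Set.Icc i (i + (ℓ - 2))) := by
    intro a ha b hb hab
    rw [Set.mem_Icc] at ha hb
    refine Nat.ModEq.eq_of_abs_lt (hcinj hab) ?_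
    rw [abs_lt]
    omega
  obtain ⟨p, hp, hplen, hsupp⟩ := SimpleGraph.exists_isPath_of_adj_succ hadj i (ℓ - 2) hinj
  have hne : c i ≠ c (i + (ℓ - 2)) := fun h => by
    have := hinj (Set.mem_Icc.2 ⟨le_rfl, by omega⟩) (Set.mem_Icc.2 ⟨by omega, le_rfl⟩) h
    omega
  have hup : u ∉ p.support := fun h => by
    obtain ⟨j, -, hj⟩ := hsupp u h
    exact hcu j hj
  have hcycle := hp.hasCycleLength hne hup hai hak
  rwa [hplen, Nat.sub_add_cancel (by omega)] at hcycle
end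

section
/- If G is a graph of order n with a hamiltonian cycle v₀v₁…v_{n−1}v₀ and maximum degree Δ, then the cycle spectrum S(G) contains at least ⌈Δ/2⌉ cycle lengths ℓ with (n+2)/2 ≤ ℓ ≤ n. -/
/-- A chord from the base vertex of a cycle closes an initial segment of it to a cycle. -/
lemma SimpleGraph.Walk.IsCycle.hasCycleLength_of_adj_getVert {V : Type*} {G : SimpleGraph V}
    {u : V} {w : G.Walk u u} (hw : w.IsCycle) {i : ℕ} (hi : 2 ≤ i) (hlt : i < w.length)
    (hadj : G.Adj u (w.getVert i)) : HasCycleLength G (i + 1) := by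
  have hlen : (w.take i).length = i := by
    rw [SimpleGraph.Walk.take_length]
    omega
  refine ⟨_, .cons hadj.symm (w.take i), ?_, by simp [hlen]⟩
  refine (SimpleGraph.Walk.cons_isCycle_iff _ _).2 ⟨hw.isPath_take hlt, fun hmem => ?_⟩
  have := (hw.isPath_take hlt).length_eq_one_of_mem_edges (Sym2.eq_swap ▸ hmem)
  omega

/-- A chord (or edge) from the base vertex of a cycle yields a cycle whose length is that of the
longer of the two cycles into which it splits the original one. -/
lemma SimpleGraph.Walk.IsCycle.hasCycleLength_max {V : Type*} {G : SimpleGraph V}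
    {u : V} {w : G.Walk u u} (hw : w.IsCycle) {i : ℕ} (hpos : 0 < i) (hlt : i < w.length)
    (hadj : G.Adj u (w.getVert i)) : HasCycleLength G (max i (w.length - i) + 1) := by
  have hthree := hw.three_le_length
  rcases le_total (w.length - i) i with h | h
  · rw [max_eq_left h]
    exact hw.hasCycleLength_of_adj_getVert (by omega) hlt hadj
  · rw [max_eq_right h]
    refine hw.reverse.hasCycleLength_of_adj_getVert (by omega) ?_ ?_
    · rw [SimpleGraph.Walk.length_reverse]
      omega
    · rwa [SimpleGraph.Walk.getVert_reverse, Nat.sub_sub_self hlt.le]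

/-- A cycle through all vertices has length equal to the order of the graph. -/
lemma SimpleGraph.Walk.IsCycle.length_eq_card {V : Type*} [Fintype V] [DecidableEq V]
    {G : SimpleGraph V} {u : V} {w : G.Walk u u} (hw : w.IsCycle) (hsupp : ∀ x, x ∈ w.support) :
    w.length = Fintype.card V := by
  refine SimpleGraph.Walk.IsHamiltonianCycle.length_eq
    (SimpleGraph.Walk.isHamiltonianCycle_iff_isCycle_and_support_count_tail_eq_one.2
      ⟨hw, fun x => List.count_eq_one_of_mem hw.support_nodup ?_⟩)
  rcases w.mem_support_iff.1 (hsupp x) with rfl | h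
  · exact w.end_mem_tail_support hw.not_nil
  · exact h

/-- If `G` is a hamiltonian graph of order `n` with maximum degree `Δ`, then the cycle
spectrum of `G` contains at least `⌈Δ/2⌉` cycle lengths `ℓ` with `(n+2)/2 ≤ ℓ ≤ n`.
(The bound `(n+2)/2 ≤ ℓ` is expressed as `n + 2 ≤ 2 * ℓ`, and `⌈Δ/2⌉ = (Δ + 1) / 2`.) -/
theorem cycle_lengths_in_upper_half {V : Type*} [Fintype V] [DecidableEq V]
    (G : SimpleGraph V) [DecidableRel G.Adj] (n Δ : ℕ)
    (hn : n = Fintype.card V) (hΔ : Δ = G.maxDegree)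
    (hham : ∃ (v : V) (w : G.Walk v v), w.IsCycle ∧ ∀ x : V, x ∈ w.support) :
    (Δ + 1) / 2 ≤ {ℓ : ℕ | n + 2 ≤ 2 * ℓ ∧ ℓ ≤ n ∧ HasCycleLength G ℓ}.ncard := by
  obtain ⟨v, w₀, hw₀, hsupp₀⟩ := hham
  have : Nonempty V := ⟨v⟩
  obtain ⟨u, hu⟩ := G.exists_maximal_degree_vertex
  obtain ⟨w, hw, hsupp⟩ : ∃ w : G.Walk u u, w.IsCycle ∧ ∀ x, x ∈ w.support :=
    ⟨w₀.rotate u (hsupp₀ u), (SimpleGraph.Walk.isCycle_rotate _).2 hw₀, fun x =>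
      (SimpleGraph.Walk.mem_support_rotate_iff _ _ _).2 (hsupp₀ x)⟩
  have hlen : w.length = n := (hw.length_eq_card hsupp).trans hn.symm
  set I := (Finset.Ioo 0 n).filter fun i => G.Adj u (w.getVert i) with hI
  have hcardI : Δ ≤ I.card := by
    rw [hΔ, hu, ← G.card_neighborFinset_eq_degree]
    refine (Finset.card_le_card fun x hx => ?_).trans (Finset.card_image_le (f := w.getVert))
    rw [SimpleGraph.mem_neighborFinset] at hx
    obtain ⟨i, rfl, hi⟩ := SimpleGraph.Walk.mem_support_iff_exists_getVert.1 (hsupp x)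
    refine Finset.mem_image_of_mem _ (Finset.mem_filter.2 ⟨Finset.mem_Ioo.2 ⟨?_, ?_⟩, hx⟩)
    · refine Nat.pos_of_ne_zero fun h => hx.ne ?_
      rw [h, SimpleGraph.Walk.getVert_zero]
    · refine hlen ▸ lt_of_le_of_ne hi fun h => hx.ne ?_
      rw [h, SimpleGraph.Walk.getVert_length]
  set f : ℕ → ℕ := fun i => max i (n - i) + 1 with hf
  have hfiber : I.card ≤ 2 * (I.image f).card := by
    refine Finset.card_le_mul_card_image I 2 fun b _ => ?_
    refine (Finset.card_le_card (t := {b - 1, n + 1 - b}) fun i hi => ?_).trans Finset.card_le_two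
    simp only [hI, hf, Finset.mem_filter, Finset.mem_Ioo] at hi
    simp only [Finset.mem_insert, Finset.mem_singleton]
    omega
  have himage : (I.image f).card ≤
      {ℓ : ℕ | n + 2 ≤ 2 * ℓ ∧ ℓ ≤ n ∧ HasCycleLength G ℓ}.ncard := by
    rw [← Set.ncard_coe_finset]
    refine Set.ncard_le_ncard (fun ℓ hℓ => ?_) ((Set.finite_Iic n).subset fun ℓ hℓ => hℓ.2.1)
    obtain ⟨i, hi, rfl⟩ := Finset.mem_image.1 (Finset.mem_coe.1 hℓ)
    simp only [hI, Finset.mem_filter, Finset.mem_Ioo] at hi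
    have hcycle := hw.hasCycleLength_max hi.1.1 (hlen ▸ hi.1.2) hi.2
    rw [hlen] at hcycle
    refine ⟨?_, ?_, hcycle⟩ <;> simp only [hf] <;> omega
  omega
end

section
/- If G is a connected graph with no independent set of three vertices, then G has a hamiltonian path, i.e., a path containing all vertices of G. -/
namespace SimpleGraph

/-- In a graph without an independent triple, a path (as a list of vertices) can be rearranged and
extended so as to also cover a given neighbour `x` of one of its vertices `y`. -/
theorem exists_isChain_perm_cons {V : Type*} {G : SimpleGraph V}
    (hind : ∀ a b c : V, a ≠ b → a ≠ c → b ≠ c →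
      ¬ G.Adj a b → ¬ G.Adj a c → ¬ G.Adj b c → False)
    {s t : List V} {x y : V} (hchain : (s ++ y :: t).IsChain G.Adj)
    (hnodup : (s ++ y :: t).Nodup) (hx : x ∉ s ++ y :: t) (hxy : G.Adj x y) :
    ∃ l : List V, l.IsChain G.Adj ∧ l.Perm (x :: (s ++ y :: t)) := by
  cases s with
  | nil => exact ⟨x :: y :: t, .cons_cons hxy hchain, .refl _⟩
  | cons a s =>
    obtain ⟨b, hb⟩ : ∃ b, (y :: t).getLast? = some b :=
      ⟨_, List.getLast?_eq_some_getLast (List.cons_ne_nil y t)⟩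
    have hbt : b ∈ y :: t := List.mem_of_getLast? hb
    by_cases hax : G.Adj x a
    · exact ⟨x :: (a :: s ++ y :: t), .cons_cons hax hchain, .refl _⟩
    by_cases hbx : G.Adj b x
    · refine ⟨a :: s ++ y :: t ++ [x], hchain.append (.singleton x) ?_,
        List.perm_append_singleton _ _⟩
      rw [List.getLast?_append, hb]
      simpa using hbx
    have hba : G.Adj b a := by
      by_contra hba
      refine hind a b x ?_ ?_ ?_ (fun h => hba h.symm) (fun h => hax h.symm) hbx
      · exact (List.nodup_append.1 hnodup).2.2 a (by simp) b hbt
      · rintro rfl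
        simp at hx
      · rintro rfl
        exact hx (List.mem_append_right _ hbt)
    have hrotate : (y :: t ++ a :: s).IsChain G.Adj := by
      refine hchain.right_of_append.append hchain.left_of_append ?_
      rw [hb]
      simpa using hba
    exact ⟨x :: (y :: t ++ a :: s), .cons_cons hxy hrotate, List.perm_append_comm.cons x⟩

end SimpleGraph

/-- If `G` is a connected (finite) graph with no independent set of three vertices,
then `G` has a hamiltonian path, i.e. a path containing all vertices of `G`. -/
theorem hamiltonian_path_of_no_independent_triple {V : Type*} [Fintype V]
    (G : SimpleGraph V) (hconn : G.Connected)
    (hind : ∀ a b c : V, a ≠ b → a ≠ c → b ≠ c →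
      ¬ G.Adj a b → ¬ G.Adj a c → ¬ G.Adj b c → False) :
    ∃ (u v : V) (p : G.Walk u v), p.IsPath ∧ ∀ x : V, x ∈ p.support := by
  let P : ℕ → Prop := fun n => ∃ l : List V, l.IsChain G.Adj ∧ l.Nodup ∧ l.length = n
  have hP : ∀ n, P n → n ≤ Fintype.card V := by
    rintro n ⟨l, -, hl, rfl⟩
    exact hl.length_le_card
  obtain ⟨v₀⟩ := hconn.nonempty
  have hP_one : P 1 := ⟨[v₀], .singleton v₀, List.nodup_singleton v₀, rfl⟩
  classical
  obtain ⟨l, hchain, hnodup, hlen⟩ : P (Nat.findGreatest P (Fintype.card V)) :=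
    Nat.findGreatest_spec (hP 1 hP_one) hP_one
  have hmax : ∀ n, P n → n ≤ l.length := fun n hn =>
    hlen ▸ Nat.le_findGreatest (hP n hn) hn
  have hne : l ≠ [] := List.ne_nil_of_length_pos (hmax 1 hP_one)
  refine ⟨_, _, SimpleGraph.Walk.ofSupport l hne hchain, ?_, ?_⟩
  · rw [SimpleGraph.Walk.isPath_def, SimpleGraph.Walk.support_ofSupport]
    exact hnodup
  rw [SimpleGraph.Walk.support_ofSupport]
  by_contra! ⟨z, hz⟩
  obtain ⟨p⟩ := hconn.preconnected (l.head hne) z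
  obtain ⟨d, -, hfst, hsnd⟩ := p.exists_boundary_dart {v | v ∈ l} (List.head_mem hne) hz
  obtain ⟨s, t, hst⟩ := List.append_of_mem (show d.fst ∈ l from hfst)
  have hd : d.snd ∉ l := hsnd
  rw [hst] at hchain hnodup hd
  obtain ⟨l', hchain', hperm⟩ :=
    SimpleGraph.exists_isChain_perm_cons hind hchain hnodup hd d.adj.symm
  have hlen' := hmax l'.length ⟨l', hchain', hperm.nodup_iff.2 (List.nodup_cons.2 ⟨hd, hnodup⟩), rfl⟩
  rw [hperm.length_eq, ← hst, List.length_cons] at hlen'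
  omega
end

section
/- If G is a claw-free hamiltonian graph of order n and maximum degree Δ with Δ ≥ 3 and ⌈(3/2)Δ⌉ ≥ n, then G is pancyclic. -/
section RunStructure

variable {α : Type*}

/-- A list splits into its longest prefix of elements satisfying `p` and the rest. -/
lemma exists_append_of_pred (p : α → Prop) (l : List α) :
    ∃ a b, l = a ++ b ∧ (∀ x ∈ a, p x) ∧ ∀ h, [h] <+: b → ¬ p h := by
  induction l with
  | nil => exact ⟨[], [], by simp⟩
  | cons c l ih =>
    by_cases hc : p c
    · obtain ⟨a, b, rfl, ha, hb⟩ := ih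
      exact ⟨c :: a, b, by simp, by simpa [hc] using ha, hb⟩
    · exact ⟨[], c :: l, by simp, by simp, by simpa using hc⟩

/-- A nonempty list whose first element satisfies `N` and whose last element does not starts with
a nonempty block of elements satisfying `N` followed by a nonempty block of elements that do
not. -/
lemma exists_run_gap {N : α → Prop} {T : List α} (hT : T ≠ [])
    (hhead : ∀ h, [h] <+: T → N h) (hlast : ∀ t, [t] <:+ T → ¬ N t) :
    ∃ A S T', T = A ++ (S ++ T') ∧ A ≠ [] ∧ S ≠ [] ∧ (∀ a ∈ A, N a) ∧ (∀ a ∈ S, ¬ N a) ∧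
      ∀ h, [h] <+: T' → N h := by
  obtain ⟨A, B, rfl, hA, hB⟩ := exists_append_of_pred N T
  obtain ⟨S, T', rfl, hS, hT'⟩ := exists_append_of_pred (fun a => ¬ N a) B
  refine ⟨A, S, T', rfl, ?_, ?_, hA, hS, fun h hh => not_not.mp (hT' h hh)⟩
  · rintro rfl
    rcases hB' : S ++ T' with _ | ⟨b, B⟩
    · simp_all
    · exact hB b (by simp [hB']) (hhead b (by simp [hB']))
  · rintro rfl
    rcases T' with _ | ⟨b, B⟩
    · obtain ⟨A', a, rfl⟩ := (List.eq_nil_or_concat A).resolve_left (by simpa using hT)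
      exact hlast a ⟨A', by simp⟩ (hA a (by simp))
    · exact hT' b (by simp) (hB b (by simp))

/-- Constraints on the word `W` describing how a cycle visits the neighbours (`N`) of a vertex,
where the neighbours of types `L` and `R` form two cliques. -/
structure RunWord (N L R : α → Prop) (r : ℕ) (W : List α) : Prop where
  disjoint : ∀ y, L y → ¬ R y
  pair : ∀ y z, [y, z] <:+: W → N y → N z → L y ∨ R z
  gap : ∀ y S z, y :: (S ++ [z]) <:+: W → N y → N z → S ≠ [] → (∀ a ∈ S, ¬ N a) →
    S.length ≤ r → L y ∧ R z
  triple : r = 1 → ∀ y w z, [y, w, z] <:+: W → N y → N w → N z → L y ∧ R z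
  not_same : ∀ u w t, [u, w, t] <:+: W → N w →
    ¬ ((¬ N u ∧ ¬ N t) ∨ (L u ∧ L t) ∨ (R u ∧ R t))

namespace RunWord

variable {N L R : α → Prop} {r : ℕ} {W : List α}

/-- A block of neighbours starting with an element of type `R` has at most two elements, all of
type `R`. -/
lemma length_le_two_of_head_right (hW : RunWord N L R r W) {a : α} {A : List α}
    (hA : ∀ x ∈ a :: A, N x) (hinf : a :: A <:+: W) (ha : R a) :
    (a :: A).length ≤ 2 ∧ ∀ A' y, a :: A = A' ++ [y] → R y := by
  have step : ∀ b c, [b, c] <:+: W → N b → N c → R b → R c := fun b c h hb hc hR =>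
    (hW.pair b c h hb hc).resolve_left fun hL => hW.disjoint b hL hR
  rcases A with _ | ⟨b, _ | ⟨c, A⟩⟩
  · exact ⟨by simp, fun A' y h => by
      rcases A' with _ | ⟨_, _⟩ <;> simp_all⟩
  · have hb := step a b hinf (hA a (by simp)) (hA b (by simp)) ha
    exact ⟨by simp, fun A' y h => by
      rcases A' with _ | ⟨_, _ | ⟨_, _⟩⟩ <;> simp_all⟩
  · have h3 : [a, b, c] <:+: W := List.IsInfix.trans ⟨[], A, by simp⟩ hinf
    have hb := step a b (List.IsInfix.trans ⟨[], [c], by simp⟩ h3) (hA a (by simp))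
      (hA b (by simp)) ha
    have hc := step b c (List.IsInfix.trans ⟨[a], [], by simp⟩ h3) (hA b (by simp))
      (hA c (by simp)) hb
    exact (hW.not_same a b c h3 (hA b (by simp)) (Or.inr (Or.inr ⟨ha, hc⟩))).elim

/-- A block of neighbours has at most five elements. -/
lemma length_le_five (hW : RunWord N L R r W) {A : List α}
    (hA : ∀ x ∈ A, N x) (hinf : A <:+: W) : A.length ≤ 5 := by
  by_contra! hlen
  obtain ⟨a, b, c, d, e, f, A, rfl⟩ : ∃ a b c d e f A', A = a :: b :: c :: d :: e :: f :: A' := by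
    rcases A with _ | ⟨a, _ | ⟨b, _ | ⟨c, _ | ⟨d, _ | ⟨e, _ | ⟨f, A⟩⟩⟩⟩⟩⟩ <;> simp at hlen ⊢
  simp only [List.mem_cons, forall_eq_or_imp] at hA
  obtain ⟨ha, hb, hc, hd, he, hf, -⟩ := hA
  have hab := hW.pair a b (List.IsInfix.trans ⟨[], c :: d :: e :: f :: A, by simp⟩ hinf) ha hb
  have hbc := hW.pair b c (List.IsInfix.trans ⟨[a], d :: e :: f :: A, by simp⟩ hinf) hb hc
  have hcd := hW.pair c d (List.IsInfix.trans ⟨[a, b], e :: f :: A, by simp⟩ hinf) hc hd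
  have hde := hW.pair d e (List.IsInfix.trans ⟨[a, b, c], f :: A, by simp⟩ hinf) hd he
  have hef := hW.pair e f (List.IsInfix.trans ⟨[a, b, c, d], A, by simp⟩ hinf) he hf
  have h1 := hW.not_same a b c (List.IsInfix.trans ⟨[], d :: e :: f :: A, by simp⟩ hinf) hb
  have h2 := hW.not_same d e f (List.IsInfix.trans ⟨[a, b, c], A, by simp⟩ hinf) he
  have hcL : ¬ L c := fun hc' => by
    have hb' := hbc.resolve_right (hW.disjoint c hc')
    exact h1 (Or.inr (Or.inl ⟨hab.resolve_right (hW.disjoint b hb'), hc'⟩))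
  have hdR := hcd.resolve_left hcL
  have heR := hde.resolve_left fun h => hW.disjoint d h hdR
  exact h2 (Or.inr (Or.inr ⟨hdR, hef.resolve_left fun h => hW.disjoint e h heR⟩))

/-- If `r = 1`, a block of neighbours has at most four elements. -/
lemma length_le_four (hW : RunWord N L R r W) (hr : r = 1) {A : List α}
    (hA : ∀ x ∈ A, N x) (hinf : A <:+: W) : A.length ≤ 4 := by
  by_contra! hlen
  obtain ⟨a, b, c, d, e, A, rfl⟩ : ∃ a b c d e A', A = a :: b :: c :: d :: e :: A' := by
    rcases A with _ | ⟨a, _ | ⟨b, _ | ⟨c, _ | ⟨d, _ | ⟨e, A⟩⟩⟩⟩⟩ <;> simp at hlen ⊢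
  simp only [List.mem_cons, forall_eq_or_imp] at hA
  obtain ⟨ha, hb, hc, hd, he, -⟩ := hA
  have h1 := hW.triple hr a b c (List.IsInfix.trans ⟨[], d :: e :: A, by simp⟩ hinf) ha hb hc
  have h2 := hW.triple hr c d e (List.IsInfix.trans ⟨[a, b], A, by simp⟩ hinf) hc hd he
  exact hW.disjoint c h2.1 h1.2

/-- A block of neighbours ending with an element of type `L` has at most two elements. -/
lemma length_le_two_of_last_left (hW : RunWord N L R r W) {A : List α} {z : α}
    (hA : ∀ x ∈ A ++ [z], N x) (hinf : A ++ [z] <:+: W) (hz : L z) :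
    (A ++ [z]).length ≤ 2 := by
  by_contra! hlen
  obtain ⟨A, y, rfl⟩ := (List.eq_nil_or_concat A).resolve_left (by rintro rfl; simp at hlen)
  obtain ⟨A, x, rfl⟩ := (List.eq_nil_or_concat A).resolve_left (by rintro rfl; simp at hlen)
  have h3 : [x, y, z] <:+: W := List.IsInfix.trans ⟨A, [], by simp⟩ hinf
  have hy := (hW.pair y z (List.IsInfix.trans ⟨[x], [], by simp⟩ h3) (hA y (by simp))
    (hA z (by simp))).resolve_right (hW.disjoint z hz)
  have hx := (hW.pair x y (List.IsInfix.trans ⟨[], [z], by simp⟩ h3) (hA x (by simp))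
    (hA y (by simp))).resolve_right (hW.disjoint y hy)
  exact hW.not_same x y z h3 (hA y (by simp)) (Or.inr (Or.inl ⟨hx, hz⟩))

/-- A block of neighbours is no longer than the two adjacent gaps together. -/
lemma length_run_le (hW : RunWord N L R r W) (hr : 1 ≤ r) {y z : α} {S A S' : List α}
    (hinf : y :: (S ++ (A ++ (S' ++ [z]))) <:+: W) (hy : N y) (hz : N z)
    (hS : S ≠ []) (hS' : S' ≠ []) (hSN : ∀ a ∈ S, ¬ N a) (hSN' : ∀ a ∈ S', ¬ N a)
    (hA : ∀ a ∈ A, N a) : A.length ≤ S.length + S'.length := by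
  have hS1 := List.length_pos_of_ne_nil hS
  have hS1' := List.length_pos_of_ne_nil hS'
  by_contra! hlen
  have hAinf : A <:+: W := List.IsInfix.trans ⟨y :: S, S' ++ [z], by simp⟩ hinf
  have h5 := hW.length_le_five hA hAinf
  have h4 := fun h => hW.length_le_four h hA hAinf
  have hSr : r < S.length := by
    by_contra! hle
    rcases A with _ | ⟨a, A⟩
    · simp at hlen
    · have := hW.gap y S a (List.IsInfix.trans ⟨[], A ++ (S' ++ [z]), by simp⟩ hinf) hy
        (hA a (by simp)) hS hSN hle
      have := (hW.length_le_two_of_head_right hA hAinf this.2).1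
      omega
  have hSr' : r < S'.length := by
    by_contra! hle
    obtain ⟨A, a, rfl⟩ := (List.eq_nil_or_concat A).resolve_left (by rintro rfl; simp at hlen)
    rw [List.concat_eq_append] at *
    have := hW.gap a S' z (List.IsInfix.trans ⟨y :: (S ++ A), [], by simp⟩ hinf)
        (hA a (by simp)) hz hS' hSN' hle
    have := hW.length_le_two_of_last_left hA hAinf this.1
    omega
  omega

open scoped Classical in
lemma countP_add_one_le (hW : RunWord N L R r W) (hr : 1 ≤ r) {y z : α} {S T : List α}
    (hinf : y :: (S ++ (T ++ [z])) <:+: W) (hy : N y) (hz : N z)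
    (hS : S ≠ []) (hSN : ∀ a ∈ S, ¬ N a)
    (hhead : ∀ h, [h] <+: T → N h) (hlast : ∀ t, [t] <:+ T → ¬ N t) :
    T.countP (fun a => N a) + 1 ≤ S.length + 2 * T.countP (fun a => ¬ N a) := by
  induction hn : T.length using Nat.strong_induction_on generalizing y S T with | _ n ih => ?_
  have hS1 := List.length_pos_of_ne_nil hS
  by_cases hT : T = []
  · subst hT; simpa using Nat.succ_le_of_lt hS1
  obtain ⟨A, S', T', rfl, hA, hS', hAN, hSN', hhead'⟩ := exists_run_gap hT hhead hlast
  obtain ⟨A', a, rfl⟩ := (List.eq_nil_or_concat A).resolve_left hA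
  rw [List.concat_eq_append] at *
  have ih := ih T'.length (by simp at hn; omega) (y := a) (S := S') (T := T')
    (List.IsInfix.trans ⟨y :: (S ++ A'), [], by simp⟩ hinf) (hAN a (by simp)) hS' hSN' hhead'
    (fun t ht => hlast t (ht.trans ⟨A' ++ [a] ++ S', by simp⟩)) rfl
  have hrun : (A' ++ [a]).length ≤ S.length + S'.length := by
    rcases T' with _ | ⟨b, T'⟩
    · exact hW.length_run_le hr (List.IsInfix.trans ⟨[], [], by simp⟩ hinf) hy hz hS hS' hSN hSN'
        hAN
    · exact hW.length_run_le hr (z := b) (List.IsInfix.trans ⟨[], T' ++ [z], by simp⟩ hinf) hy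
        (hhead' b (by simp)) hS hS' hSN hSN' hAN
  have e1 : (A' ++ [a]).countP (fun a => N a) = (A' ++ [a]).length :=
    List.countP_eq_length.2 (by simpa using hAN)
  have e2 : (A' ++ [a]).countP (fun a => ¬ N a) = 0 := List.countP_eq_zero.2 (by simpa using hAN)
  have e3 : S'.countP (fun a => ¬ N a) = S'.length := List.countP_eq_length.2 (by simpa using hSN')
  have e4 : S'.countP (fun a => N a) = 0 := List.countP_eq_zero.2 (by simpa using hSN')
  rw [List.countP_append (l₁ := A' ++ [a]), List.countP_append (l₁ := A' ++ [a]),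
    List.countP_append (l₁ := S'), List.countP_append (l₁ := S'), e1, e2, e3, e4]
  omega

open scoped Classical in
/-- In a word `C` that starts and ends with non-neighbours and contains a neighbour, the
neighbours are few. -/
lemma countP_core_le (hr : 1 ≤ r) {y z : α} {C : List α}
    (hW : RunWord N L R r (y :: (C ++ [z]))) (hy : N y) (hz : N z)
    (hhead : ∀ h, [h] <+: C → ¬ N h) (hlast : ∀ t, [t] <:+ C → ¬ N t) (hC : ∃ a ∈ C, N a) :
    C.countP (fun a => N a) + (r + 1) ≤ 2 * C.countP (fun a => ¬ N a) := by
  obtain ⟨S, T, rfl, hSN, hheadT⟩ := exists_append_of_pred (fun a => ¬ N a) C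
  simp only [not_not] at hheadT
  have hT : T ≠ [] := by
    rintro rfl
    obtain ⟨a, ha, haN⟩ := hC
    exact hSN a (by simpa using ha) haN
  have hS : S ≠ [] := by
    rintro rfl
    obtain ⟨b, T, rfl⟩ := List.exists_cons_of_ne_nil hT
    exact hhead b (by simp) (hheadT b (by simp))
  have hS1 := List.length_pos_of_ne_nil hS
  have e3 : S.countP (fun a => ¬ N a) = S.length := List.countP_eq_length.2 (by simpa using hSN)
  have e4 : S.countP (fun a => N a) = 0 := List.countP_eq_zero.2 (by simpa using hSN)
  have hlastT : ∀ t, [t] <:+ T → ¬ N t := fun t ht => hlast t (ht.trans ⟨S, by simp⟩)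
  rw [List.countP_append, List.countP_append, e3, e4]
  by_cases hSr : r < S.length
  · have := hW.countP_add_one_le hr (y := y) (S := S) (T := T) (z := z) ⟨[], [], by simp⟩ hy hz hS
      hSN hheadT hlastT
    omega
  obtain ⟨A, S', T', rfl, hA, hS', hAN, hSN', hhead'⟩ := exists_run_gap hT hheadT hlastT
  obtain ⟨b, B, hb⟩ := List.exists_cons_of_ne_nil hA
  obtain ⟨A', a, ha⟩ := (List.eq_nil_or_concat A).resolve_left hA
  rw [List.concat_eq_append] at ha
  have hbR : R b := (hW.gap y S b ⟨[], B ++ (S' ++ (T' ++ [z])), by simp [hb]⟩ hy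
    (hAN b (by simp [hb])) hS hSN (by omega)).2
  have hAlen := hW.length_le_two_of_head_right (a := b) (A := B) (by simpa [hb] using hAN)
    ⟨y :: S, S' ++ (T' ++ [z]), by simp [hb]⟩ hbR
  have haR := hAlen.2 A' a (by rw [← hb, ha])
  have hS'r : r < S'.length := by
    by_contra! hle
    have haN := hAN a (by simp [ha])
    have haL : L a := by
      rcases T' with _ | ⟨c, T'⟩
      · exact (hW.gap a S' z ⟨y :: (S ++ A'), [], by simp [ha]⟩ haN hz hS' hSN' hle).1
      · exact (hW.gap a S' c ⟨y :: (S ++ A'), T' ++ [z], by simp [ha]⟩ haN (hhead' c (by simp))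
          hS' hSN' hle).1
    exact hW.disjoint a haL haR
  have := hW.countP_add_one_le hr (y := a) (S := S') (T := T') (z := z)
    ⟨y :: (S ++ A'), [], by simp [ha]⟩ (hAN a (by simp [ha])) hz hS' hSN' hhead'
    fun t ht => hlastT t (ht.trans ⟨A ++ S', by simp⟩)
  have e1 : A.countP (fun a => N a) = A.length := List.countP_eq_length.2 (by simpa using hAN)
  have e2 : A.countP (fun a => ¬ N a) = 0 := List.countP_eq_zero.2 (by simpa using hAN)
  have e5 : S'.countP (fun a => ¬ N a) = S'.length := List.countP_eq_length.2 (by simpa using hSN')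
  have e6 : S'.countP (fun a => N a) = 0 := List.countP_eq_zero.2 (by simpa using hSN')
  rw [List.countP_append, List.countP_append, List.countP_append, List.countP_append, e1, e2, e5,
    e6]
  have := hAlen.1
  rw [← hb] at this
  omega

end RunWord

end RunStructure

section CycleThrough

variable {V : Type*} {G : SimpleGraph V} {v : V}

/-- `v :: Q` lists the vertices of a cycle of `G` in cyclic order. -/
def IsCycleThrough (G : SimpleGraph V) (v : V) (Q : List V) : Prop :=
  (v :: (Q ++ [v])).IsChain G.Adj ∧ (v :: Q).Nodup

lemma isCycleThrough_iff {Q : List V} (hQ : Q ≠ []) :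
    IsCycleThrough G v Q ↔ Q.IsChain G.Adj ∧ (v :: Q).Nodup ∧
      (∀ a ∈ Q.head?, G.Adj v a) ∧ ∀ a ∈ Q.getLast?, G.Adj v a := by
  rw [IsCycleThrough, List.isChain_cons, List.isChain_append]
  obtain ⟨a, Q, rfl⟩ := List.exists_cons_of_ne_nil hQ
  simp only [List.cons_append, List.head?_cons, Option.mem_some_iff, forall_eq',
    List.isChain_singleton, true_and, List.nodup_cons, G.adj_comm v]
  tauto

lemma isChain_adj_reverse {l : List V} : l.reverse.IsChain G.Adj ↔ l.IsChain G.Adj := by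
  rw [List.isChain_reverse]
  simp only [G.adj_comm]

namespace IsCycleThrough

lemma hasCycleLength {Q : List V} (h : IsCycleThrough G v Q) (hQ : 2 ≤ Q.length) :
    HasCycleLength G (Q.length + 1) := by
  obtain ⟨w, hw⟩ : ∃ w : G.Walk v v, w.support = v :: (Q ++ [v]) := by
    have hlast : (v :: (Q ++ [v])).getLast (List.cons_ne_nil _ _) = v := by simp
    have hchain : (v :: (Q ++ [v])).IsChain G.Adj := h.1
    refine ⟨(SimpleGraph.Walk.ofSupport _ (List.cons_ne_nil _ _) hchain).copy
      List.head_cons hlast, ?_⟩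
    rw [SimpleGraph.Walk.support_copy, SimpleGraph.Walk.support_ofSupport]
  have hl : w.length = Q.length + 1 := by
    have := w.length_support
    rw [hw] at this
    simpa using this.symm
  refine ⟨v, w, ?_, hl⟩
  rw [SimpleGraph.Walk.isCycle_iff_isPath_tail_and_le_length]
  refine ⟨?_, by omega⟩
  rw [SimpleGraph.Walk.isPath_def, SimpleGraph.Walk.support_tail_of_not_nil, hw]
  · have hv := List.nodup_cons.1 h.2
    rw [List.tail_cons, List.nodup_append]
    refine ⟨hv.2, by simp, ?_⟩
    rintro a ha b hb rfl
    exact hv.1 (List.mem_singleton.1 hb ▸ ha)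
  · rw [SimpleGraph.Walk.not_nil_iff_lt_length]
    omega

lemma infix_of_adj {P Q : List V} (h : IsCycleThrough G v P) (hQP : Q <:+: P) (hQ : Q ≠ [])
    (hhead : ∀ a ∈ Q.head?, G.Adj v a) (hlast : ∀ a ∈ Q.getLast?, G.Adj v a) :
    IsCycleThrough G v Q := by
  have hP : P ≠ [] := by
    rintro rfl
    exact hQ (List.eq_nil_of_infix_nil hQP)
  rw [isCycleThrough_iff hP] at h
  rw [isCycleThrough_iff hQ]
  exact ⟨h.1.infix hQP, h.2.1.sublist (hQP.sublist.cons_cons v), hhead, hlast⟩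

lemma reverse {P : List V} (h : IsCycleThrough G v P) : IsCycleThrough G v P.reverse := by
  refine ⟨?_, by simpa using h.2⟩
  have := isChain_adj_reverse.2 h.1
  simpa using this

/-- Cutting the list `W` out of a cycle. -/
lemma cut {S W T : List V} {y z : V} (h : IsCycleThrough G v (S ++ y :: (W ++ z :: T)))
    (hyz : G.Adj y z) : IsCycleThrough G v (S ++ y :: z :: T) := by
  refine ⟨?_, h.2.sublist ?_⟩
  · have h1 := h.1
    simp only [List.cons_append, List.append_assoc] at h1 ⊢
    rw [← List.cons_append, List.isChain_split] at h1 ⊢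
    refine ⟨h1.1, ?_⟩
    rw [List.isChain_cons_cons]
    refine ⟨hyz, ?_⟩
    have h2 := h1.2
    rw [← List.cons_append, List.isChain_split] at h2
    exact h2.2
  · simp

/-- Cutting the list `W` out of a cycle and reversing what precedes it. -/
lemma cut_reverse_left {S S' W T : List V} {p y z : V}
    (h : IsCycleThrough G v (S ++ y :: (W ++ z :: T))) (hp : S ++ [y] = p :: S')
    (hvy : G.Adj v y) (hpz : G.Adj p z) :
    IsCycleThrough G v ((S ++ [y]).reverse ++ z :: T) := by
  have hne : (S ++ y :: (W ++ z :: T)) ≠ [] := by simp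
  have e : S ++ y :: (W ++ z :: T) = (S ++ [y]) ++ (W ++ z :: T) := by simp
  rw [isCycleThrough_iff hne] at h
  obtain ⟨h1, h2, h3, h4⟩ := h
  rw [isCycleThrough_iff (by simp)]
  refine ⟨?_, ?_, ?_, ?_⟩
  · obtain ⟨ha, hb, -⟩ := List.isChain_append.1 (e ▸ h1)
    rw [List.isChain_append, isChain_adj_reverse]
    refine ⟨ha, (List.isChain_append.1 hb).2.1, ?_⟩
    rw [hp]
    simpa using hpz
  · have hs : (v :: ((S ++ [y]) ++ z :: T)).Nodup := h2.sublist (by simp)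
    exact hs.perm (((S ++ [y]).reverse_perm.symm.append_right _).cons v)
  · simpa using hvy
  · simp only [List.getLast?_append, List.getLast?_cons] at h4 ⊢
    simpa using h4

/-- Cutting the list `W` out of a cycle and reversing what follows it. -/
lemma cut_reverse_right {S W T T' : List V} {q y z : V}
    (h : IsCycleThrough G v (S ++ y :: (W ++ z :: T))) (hq : z :: T = T' ++ [q])
    (hvz : G.Adj v z) (hyq : G.Adj y q) :
    IsCycleThrough G v (S ++ y :: (z :: T).reverse) := by
  have := (cut_reverse_left (S := T.reverse) (S' := T'.reverse) (y := z) (W := W.reverse)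
    (T := S.reverse) (p := q) (z := y) (by simpa using h.reverse)
    (by simpa using congrArg List.reverse hq) hvz hyq.symm).reverse
  simpa using this

end IsCycleThrough

lemma exists_getElem_of_countP_lt {α : Type*} (p : α → Prop) [DecidablePred p] :
    ∀ l₁ l₂ : List α, l₁.length = l₂.length →
      l₁.countP (fun a => ¬ p a) + l₂.countP (fun a => ¬ p a) < l₁.length →
      ∃ (k : ℕ) (h₁ : k < l₁.length) (h₂ : k < l₂.length), p l₁[k] ∧ p l₂[k]
  | [], _, _, h => by simp at h
  | a :: l₁, [], h, _ => by simp at h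
  | a :: l₁, b :: l₂, h, hc => by
    by_cases hab : p a ∧ p b
    · exact ⟨0, by simp, by simp, by simpa using hab⟩
    · obtain ⟨k, h₁, h₂, hk⟩ := exists_getElem_of_countP_lt p l₁ l₂ (by simpa using h) (by
        simp only [List.countP_cons, List.length_cons] at hc
        by_cases ha : p a <;> by_cases hb : p b <;> simp_all <;> omega)
      exact ⟨k + 1, by simpa using h₁, by simpa using h₂, by simpa using hk⟩

open scoped Classical in
/-- If the two cycle neighbours of `v` are adjacent and more than half of the other vertices of the
cycle are neighbours of `v`, there are cycles of all lengths. -/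
lemma IsCycleThrough.hasCycleLength_of_adj_ends {P P₁ P₂ : List V} {p q : V}
    (h : IsCycleThrough G v P) (hp : P = p :: P₁) (hq : P = P₂ ++ [q]) (hpq : G.Adj p q)
    (hc : 2 * P.countP (fun a => ¬ G.Adj v a) < P.length) {ℓ : ℕ} (h3 : 3 ≤ ℓ)
    (hℓ : ℓ ≤ P.length) : HasCycleLength G ℓ := by
  obtain ⟨k, hk, hk', hkN, hkN'⟩ := exists_getElem_of_countP_lt (G.Adj v) P (P.rotate (ℓ - 2))
    (by simp) (by rw [(P.rotate_perm (ℓ - 2)).countP_eq]; omega)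
  have hne : P ≠ [] := by simp [hp]
  have h' := (isCycleThrough_iff hne).1 h
  have hrot : (P.rotate k).IsChain G.Adj := by
    rw [List.rotate_eq_drop_append_take hk.le, List.isChain_append]
    refine ⟨h'.1.drop k, h'.1.take k, ?_⟩
    intro x hx y hy
    rw [List.getLast?_drop, if_neg (by omega), hq] at hx
    have hxq : x = q := by simpa using hx.symm
    rw [hp] at hy
    rcases k with _ | k
    · simp at hy
    · have : y = p := by simpa using hy.symm
      exact hxq ▸ this ▸ hpq.symm
  set Q := (P.rotate k).take (ℓ - 1) with hQ
  have hQl : Q.length = ℓ - 1 := by simp [hQ]; omega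
  have hQne : Q ≠ [] := by rintro h0; simp [h0] at hQl; omega
  have hcyc : IsCycleThrough G v Q := by
    rw [isCycleThrough_iff hQne]
    refine ⟨hrot.take _, ?_, ?_, ?_⟩
    · refine List.Nodup.sublist ((List.take_sublist _ _).cons_cons v) ?_
      exact h'.2.1.perm ((P.rotate_perm k).symm.cons v)
    · intro a ha
      rw [List.head?_eq_getElem?, hQ, List.getElem?_take, if_pos (by omega),
        List.getElem?_rotate (by omega)] at ha
      rw [Nat.zero_add, Nat.mod_eq_of_lt hk, List.getElem?_eq_getElem hk] at ha
      have : P[k] = a := by simpa using ha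
      exact this ▸ hkN
    · intro a ha
      rw [List.getLast?_eq_getElem?, hQl, hQ, List.getElem?_take, if_pos (by omega),
        List.getElem?_rotate (by omega)] at ha
      rw [List.getElem_rotate] at hkN'
      rw [show ℓ - 1 - 1 + k = k + (ℓ - 2) by omega,
        List.getElem?_eq_getElem (Nat.mod_lt _ (by omega))] at ha
      have := Option.mem_some_iff.1 ha
      exact this ▸ hkN'
  have := hcyc.hasCycleLength (by omega)
  rwa [hQl, show ℓ - 1 + 1 = ℓ by omega] at this

end CycleThrough
section Critical

variable {V : Type*} {G : SimpleGraph V} {v p q : V} {ℓ δ x : ℕ}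

/-- `y` is a neighbour of `v` that is neither equal nor adjacent to `q`. -/
def FarNeighbor (G : SimpleGraph V) (v q y : V) : Prop :=
  G.Adj v y ∧ y ≠ q ∧ ¬ G.Adj y q

lemma FarNeighbor.adj {y z : V} (hclaw : ClawFree G) (hq : G.Adj v q) (hy : FarNeighbor G v q y)
    (hz : FarNeighbor G v q z) (hyz : y ≠ z) : G.Adj y z := by
  by_contra h
  exact hclaw v y z q hy.1 hz.1 hq hyz hy.2.1 hz.2.1 h hy.2.2 hz.2.2

lemma FarNeighbor.not_of_not_adj {y : V} (hclaw : ClawFree G) (hp : G.Adj v p) (hq : G.Adj v q)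
    (hne : p ≠ q) (hpq : ¬ G.Adj p q) (hy : FarNeighbor G v q y) : ¬ FarNeighbor G v p y :=
  fun h => hclaw v y p q h.1 hp hq h.2.1 hy.2.1 hne h.2.2 hy.2.2 hpq

lemma adj_of_not_farNeighbor {y : V} (hy : G.Adj v y) (hne : y ≠ q)
    (h : ¬ FarNeighbor G v q y) : G.Adj y q := by
  by_contra h'
  exact h ⟨hy, hne, h'⟩

open scoped Classical in
/-- `v :: Q` is a cycle on which `v` has `δ` neighbours and `x` non-neighbours. -/
structure IsCycleWith (G : SimpleGraph V) (v : V) (δ x : ℕ) (Q : List V) : Prop where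
  cycle : IsCycleThrough G v Q
  countP_adj : Q.countP (fun a => G.Adj v a) = δ
  countP_not_adj : Q.countP (fun a => ¬ G.Adj v a) = x

open scoped Classical in
lemma length_eq_countP_adj_add (G : SimpleGraph V) (v : V) (Q : List V) :
    Q.length = Q.countP (fun a => G.Adj v a) + Q.countP (fun a => ¬ G.Adj v a) := by
  simpa using Q.length_eq_countP_add_countP (fun a => decide (G.Adj v a))

lemma IsCycleWith.length {Q : List V} (h : IsCycleWith G v δ x Q) : Q.length = δ + x := by
  rw [length_eq_countP_adj_add G v, h.countP_adj, h.countP_not_adj]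

lemma IsCycleWith.of_perm {P Q : List V} (h : IsCycleWith G v δ x P) (hQ : IsCycleThrough G v Q)
    (hPQ : Q.Perm P) : IsCycleWith G v δ x Q :=
  ⟨hQ, by rw [hPQ.countP_eq, h.countP_adj], by rw [hPQ.countP_eq, h.countP_not_adj]⟩

/-- The parameters of a minimal counterexample: there is no cycle of length `ℓ`, and the claim
holds for cycles through `v` with fewer non-neighbours of `v`. -/
structure IsCritical (G : SimpleGraph V) (v : V) (ℓ δ x : ℕ) : Prop where
  clawFree : ClawFree G
  three_le : 3 ≤ ℓ
  le_add : ℓ ≤ δ + x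
  lt_count : 2 * x < δ
  not_hasCycleLength : ¬ HasCycleLength G ℓ
  not_shorter : ∀ y Q, y < x → IsCycleWith G v δ y Q → δ + y + 1 < ℓ

lemma exists_cons_eq_append_singleton {α : Type*} {S T P : List α} {z q : α}
    (h : S ++ z :: T = P ++ [q]) : ∃ T', z :: T = T' ++ [q] := by
  refine ⟨(z :: T).dropLast, ?_⟩
  have hl : (z :: T).getLast (by simp) = q := by
    have := congrArg List.getLast? h
    rw [List.getLast?_append_of_ne_nil _ (by simp), List.getLast?_concat,
      List.getLast?_eq_some_getLast (by simp)] at this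
    simpa using this
  rw [← hl, List.dropLast_append_getLast]

namespace IsCritical

lemma not_adj_ends {P P₁ P₂ : List V} (hcr : IsCritical G v ℓ δ x) (h : IsCycleWith G v δ x P)
    (hp : P = p :: P₁) (hq : P = P₂ ++ [q]) : ¬ G.Adj p q := by
  classical
  intro hpq
  have := h.length
  refine hcr.not_hasCycleLength (h.cycle.hasCycleLength_of_adj_ends hp hq hpq ?_ hcr.three_le ?_)
  · rw [h.countP_not_adj]
    have := hcr.lt_count
    omega
  · have := hcr.le_add
    omega

section Cut

variable {P P₁ P₂ S W T : List V} {y z : V} (hcr : IsCritical G v ℓ δ x)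
  (h : IsCycleWith G v δ x P) (hp : P = p :: P₁) (hq : P = P₂ ++ [q])
  (hP : P = S ++ y :: (W ++ z :: T)) (hy : G.Adj v y) (hz : G.Adj v z)

include h hp hP hy hz in
lemma _root_.IsCycleWith.cut_left (hpz : ¬ FarNeighbor G v p z) :
    IsCycleThrough G v ((S ++ [y]).reverse ++ z :: T) := by
  have hc := h.cycle
  obtain ⟨S', hS⟩ : ∃ S', S ++ [y] = p :: S' := by
    rcases S with _ | ⟨s, S⟩ <;> simp_all
  have hne : z ≠ p := by
    rintro rfl
    have hn := (List.nodup_cons.1 hc.2).2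
    rw [hP, show S ++ y :: (W ++ z :: T) = (S ++ [y]) ++ (W ++ z :: T) by simp, hS] at hn
    simp at hn
  exact (hP ▸ hc).cut_reverse_left hS hy (adj_of_not_farNeighbor hz hne hpz).symm

include h hq hP hy hz in
lemma _root_.IsCycleWith.cut_right (hqy : ¬ FarNeighbor G v q y) :
    IsCycleThrough G v (S ++ y :: (z :: T).reverse) := by
  have hc := h.cycle
  obtain ⟨T', hT⟩ : ∃ T', z :: T = T' ++ [q] :=
    exists_cons_eq_append_singleton (S := S ++ y :: W) (by simpa [hP] using hq)
  have hne : y ≠ q := by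
    rintro rfl
    have hn := (List.nodup_cons.1 h.cycle.2).2
    rw [hP, hT, List.nodup_append] at hn
    simp at hn
  exact (hP ▸ hc).cut_reverse_right hT hz (adj_of_not_farNeighbor hy hne hqy)

include hcr h hp hq hP hy hz in
lemma farNeighbor_or (hW : W = []) : FarNeighbor G v q y ∨ FarNeighbor G v p z := by
  subst hW
  by_contra hcon
  push Not at hcon
  have hc := h.cut_left hp hP hy hz hcon.2
  obtain ⟨T', hT⟩ : ∃ T', z :: T = T' ++ [q] :=
    exists_cons_eq_append_singleton (S := S ++ [y]) (by simpa [hP] using hq)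
  have hne : y ≠ q := by
    rintro rfl
    have hn := (List.nodup_cons.1 h.cycle.2).2
    rw [hP, List.nil_append, hT, List.nodup_append] at hn
    simp at hn
  have hyq := adj_of_not_farNeighbor hy hne hcon.1
  refine hcr.not_adj_ends (h.of_perm hc ?_) (P₁ := S.reverse ++ z :: T)
    (P₂ := (S ++ [y]).reverse ++ T') (by simp) (by simp [hT]) hyq
  rw [hP]
  simpa using ((S ++ [y]).reverse_perm.append_right (z :: T))

include h hp hq hP hy hz in
lemma farNeighbor_and (hno : ∀ Q : List V, Q.Perm (S ++ y :: z :: T) → ¬ IsCycleThrough G v Q) :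
    FarNeighbor G v q y ∧ FarNeighbor G v p z := by
  constructor
  · by_contra hcon
    refine hno _ ?_ (h.cut_right hq hP hy hz hcon)
    exact ((z :: T).reverse_perm.cons y).append_left S
  · by_contra hcon
    refine hno _ ?_ (h.cut_left hp hP hy hz hcon)
    simpa using ((S ++ [y]).reverse_perm.append_right (z :: T))

include hcr h hp hq hP hy hz in
lemma farNeighbor_and_of_gap (hW : W ≠ []) (hWN : ∀ a ∈ W, ¬ G.Adj v a)
    (hWℓ : W.length + ℓ ≤ δ + x + 1) : FarNeighbor G v q y ∧ FarNeighbor G v p z := by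
  classical
  refine farNeighbor_and h hp hq hP hy hz fun Q hQ hc => ?_
  have h1 := h.countP_adj
  have h2 := h.countP_not_adj
  have hWa : W.countP (fun a => G.Adj v a) = 0 := List.countP_eq_zero.2 (by simpa using hWN)
  have hWx : W.countP (fun a => ¬ G.Adj v a) = W.length :=
    List.countP_eq_length.2 (by simpa using hWN)
  have hpos := List.length_pos_iff.2 hW
  rw [hP] at h1 h2
  simp only [List.countP_append, List.countP_cons, hWa, hWx] at h1 h2
  have := hcr.not_shorter (x - W.length) Q (by omega) ⟨hc, ?_, ?_⟩
  · omega
  · rw [hQ.countP_eq]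
    simp only [List.countP_append, List.countP_cons]
    omega
  · rw [hQ.countP_eq]
    simp only [List.countP_append, List.countP_cons]
    omega

include hcr h hp hq hP hy hz in
lemma farNeighbor_and_of_length (hWℓ : W.length + ℓ = δ + x + 1) :
    FarNeighbor G v q y ∧ FarNeighbor G v p z := by
  refine farNeighbor_and h hp hq hP hy hz fun Q hQ hc => ?_
  have hl := h.length
  have hQl := hQ.length_eq
  rw [hP] at hl
  simp only [List.length_append, List.length_cons] at hl hQl
  have := hc.hasCycleLength (by omega)
  rw [show Q.length + 1 = ℓ by omega] at this
  exact hcr.not_hasCycleLength this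

end Cut

end IsCritical

end Critical
section Decomposition

variable {V : Type*} {G : SimpleGraph V} {v p q : V} {ℓ δ x : ℕ}

lemma IsCycleThrough.cons_of_adj {w : V} {P : List V} (h : IsCycleThrough G v (p :: P))
    (hw : w ∉ p :: P) (hvw : G.Adj v w) (hwp : G.Adj w p) :
    IsCycleThrough G v (w :: p :: P) := by
  have h1 := h.1
  have h2 := List.nodup_cons.1 h.2
  refine ⟨?_, ?_⟩
  · simp only [List.cons_append, List.isChain_cons_cons] at h1 ⊢
    exact ⟨hvw, hwp, h1.2⟩
  · refine List.nodup_cons.2 ⟨?_, List.nodup_cons.2 ⟨hw, h2.2⟩⟩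
    rw [List.mem_cons]
    rintro (rfl | hm)
    · exact G.irrefl hvw
    · exact h2.1 hm

lemma IsCycleThrough.concat_of_adj {w : V} {P : List V} (h : IsCycleThrough G v (P ++ [q]))
    (hw : w ∉ P ++ [q]) (hvw : G.Adj v w) (hwq : G.Adj w q) :
    IsCycleThrough G v (P ++ [q, w]) := by
  have := (IsCycleThrough.cons_of_adj (P := P.reverse) (by simpa using h.reverse)
    (by simpa [or_comm] using hw) hvw hwq).reverse
  simpa using this

namespace IsCritical

lemma not_isInfix_of_adj {P Q : List V} (hcr : IsCritical G v ℓ δ x) (h : IsCycleWith G v δ x P)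
    (hQP : Q <:+: P) (hQ : Q.length + 1 = ℓ) (hhead : ∀ a ∈ Q.head?, G.Adj v a)
    (hlast : ∀ a ∈ Q.getLast?, G.Adj v a) : False := by
  have h3 := hcr.three_le
  have hne : Q ≠ [] := by
    rintro rfl
    simp at hQ
    omega
  exact hcr.not_hasCycleLength
    (hQ ▸ (h.cycle.infix_of_adj hQP hne hhead hlast).hasCycleLength (by omega))

lemma not_isInfix_of_forall {P Q : List V} (hcr : IsCritical G v ℓ δ x) (h : IsCycleWith G v δ x P)
    (hQP : Q <:+: P) (hQ : ℓ ≤ Q.length + 1) (hQN : ∀ a ∈ Q, G.Adj v a) : False := by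
  have h3 := hcr.three_le
  refine hcr.not_isInfix_of_adj h (Q := Q.take (ℓ - 1))
    (List.IsInfix.trans ⟨[], Q.drop (ℓ - 1), by simp⟩ hQP) ?_ ?_ ?_
  · rw [List.length_take]
    omega
  · exact fun a ha => hQN a (List.mem_of_mem_take (List.mem_of_mem_head? ha))
  · exact fun a ha => hQN a (List.mem_of_mem_take (List.mem_of_mem_getLast? ha))

variable {A B C : List V} (hcr : IsCritical G v ℓ δ x) (h : IsCycleWith G v δ x (A ++ (C ++ B)))
  (hA0 : A ≠ []) (hB0 : B ≠ []) (hA : ∀ a ∈ A, G.Adj v a) (hB : ∀ b ∈ B, G.Adj v b)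

include hcr h hA0 hB0 hA hB in
lemma length_add_length_le : A.length + B.length + ℓ ≤ δ + x + 2 := by
  by_contra! hlt
  have hl := h.length
  simp only [List.length_append] at hl
  have hA1 := List.length_pos_iff.2 hA0
  have hB1 := List.length_pos_iff.2 hB0
  have hle := hcr.le_add
  obtain ⟨i, k, hi, hk, hkB, hik⟩ : ∃ i k, i < A.length ∧ 0 < k ∧ k ≤ B.length ∧
      A.length - i + (C.length + k) + 1 = ℓ := by
    by_cases hs : δ + x + 1 - ℓ < A.length
    · exact ⟨δ + x + 1 - ℓ, B.length, by omega, by omega, by omega, by omega⟩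
    · exact ⟨A.length - 1, ℓ - 2 - C.length, by omega, by omega, by omega, by omega⟩
  have hA' : A.drop i ≠ [] := by simpa using hi
  have hB' : B.take k ≠ [] := by simp [hB0]; omega
  refine hcr.not_isInfix_of_adj h (Q := A.drop i ++ (C ++ B.take k))
    ⟨A.take i, B.drop k, ?_⟩ ?_ ?_ ?_
  · simp only [List.append_assoc, List.take_append_drop]
    rw [← List.append_assoc, List.take_append_drop]
  · simp only [List.length_append, List.length_drop, List.length_take]
    omega
  · intro a ha
    rw [List.head?_append_of_ne_nil _ hA'] at ha
    exact hA a (List.mem_of_mem_drop (List.mem_of_mem_head? ha))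
  · intro a ha
    rw [List.getLast?_append_of_ne_nil _ (by simp [hB']),
      List.getLast?_append_of_ne_nil _ hB'] at ha
    exact hB a (List.mem_of_mem_take (List.mem_of_mem_getLast? ha))

include h hA hB in
open scoped Classical in
lemma countP_core :
    A.length + B.length + C.countP (fun a => G.Adj v a) = δ ∧
      C.countP (fun a => ¬ G.Adj v a) = x := by
  have h1 := h.countP_adj
  have h2 := h.countP_not_adj
  have hA1 : A.countP (fun a => G.Adj v a) = A.length := List.countP_eq_length.2 (by simpa using hA)
  have hB1 : B.countP (fun a => G.Adj v a) = B.length := List.countP_eq_length.2 (by simpa using hB)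
  have hA2 : A.countP (fun a => ¬ G.Adj v a) = 0 := List.countP_eq_zero.2 (by simpa using hA)
  have hB2 : B.countP (fun a => ¬ G.Adj v a) = 0 := List.countP_eq_zero.2 (by simpa using hB)
  simp only [List.countP_append, hA1, hB1, hA2, hB2] at h1 h2
  omega

include hcr h hA0 hB0 hA hB in
lemma exists_adj_core : ∃ a ∈ C, G.Adj v a := by
  classical
  by_contra! hC
  have hle := hcr.length_add_length_le h hA0 hB0 hA hB
  obtain ⟨h1, h2⟩ := countP_core h hA hB
  have hC1 : C.countP (fun a => G.Adj v a) = 0 := List.countP_eq_zero.2 (by simpa using hC)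
  have hlt := hcr.lt_count
  by_cases hAB : B.length ≤ A.length
  · exact hcr.not_isInfix_of_forall h (List.prefix_append _ _).isInfix (by omega) hA
  · exact hcr.not_isInfix_of_forall h ⟨A ++ C, [], by simp⟩ (by omega) hB

end IsCritical

end Decomposition
section Main

variable {V : Type*} {G : SimpleGraph V} {v p q : V} {ℓ δ x : ℕ}

/-- A neighbour `w` of `v` inside the core whose two cycle neighbours are adjacent can be moved to
an end of the cycle. -/
lemma IsCycleWith.exists_relocate {A₁ B₁ S T : List V} {u w t : V}
    (h : IsCycleWith G v δ x ((p :: A₁) ++ ((S ++ u :: w :: t :: T) ++ (B₁ ++ [q]))))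
    (hA : ∀ a ∈ p :: A₁, G.Adj v a) (hB : ∀ b ∈ B₁ ++ [q], G.Adj v b) (hw : G.Adj v w)
    (hut : G.Adj u t) (hwpq : ¬ FarNeighbor G v q w ∨ ¬ FarNeighbor G v p w) :
    ∃ A B : List V, A ≠ [] ∧ B ≠ [] ∧ (∀ a ∈ A, G.Adj v a) ∧ (∀ b ∈ B, G.Adj v b) ∧
      IsCycleWith G v δ x (A ++ ((S ++ u :: t :: T) ++ B)) := by
  have hcut : IsCycleThrough G v ((p :: A₁) ++ ((S ++ u :: t :: T) ++ (B₁ ++ [q]))) := by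
    have := IsCycleThrough.cut (S := (p :: A₁) ++ S) (W := [w]) (T := T ++ (B₁ ++ [q]))
      (by simpa using h.cycle) hut
    simpa using this
  have hperm : (w :: ((p :: A₁) ++ ((S ++ u :: t :: T) ++ (B₁ ++ [q])))).Perm
      ((p :: A₁) ++ ((S ++ u :: w :: t :: T) ++ (B₁ ++ [q]))) := by
    have := (List.perm_middle (a := w) (l₁ := (p :: A₁) ++ (S ++ [u]))
      (l₂ := t :: T ++ (B₁ ++ [q]))).symm
    simpa using this
  have hn := (hperm.nodup_iff.2 (List.nodup_cons.1 h.cycle.2).2)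
  have hnw := (List.nodup_cons.1 hn).1
  rcases hwpq with hq | hp
  · have hne : w ≠ q := by
      rintro rfl
      simp at hnw
    have hc := IsCycleThrough.concat_of_adj (P := (p :: A₁) ++ ((S ++ u :: t :: T) ++ B₁))
      (by simpa using hcut) (by simpa using hnw) hw (adj_of_not_farNeighbor hw hne hq)
    refine ⟨p :: A₁, B₁ ++ [q, w], by simp, by simp, hA, ?_, h.of_perm (by simpa using hc) ?_⟩
    · intro b hb
      rw [show B₁ ++ [q, w] = (B₁ ++ [q]) ++ [w] by simp, List.mem_append] at hb
      rcases hb with hb | hb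
      · exact hB b hb
      · exact List.mem_singleton.1 hb ▸ hw
    · refine List.Perm.trans ?_ hperm
      have := List.perm_append_singleton w ((p :: A₁) ++ ((S ++ u :: t :: T) ++ (B₁ ++ [q])))
      simpa using this
  · have hne : w ≠ p := by
      rintro rfl
      simp at hnw
    have hc := IsCycleThrough.cons_of_adj hcut hnw hw (adj_of_not_farNeighbor hw hne hp)
    refine ⟨w :: p :: A₁, B₁ ++ [q], by simp, by simp, ?_, hB, h.of_perm hc hperm⟩
    intro a ha
    rcases List.mem_cons.1 ha with rfl | ha
    · exact hw
    · exact hA a ha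

lemma exists_eq_append_of_infix_cons_concat {α : Type*} {N : α → Prop} {C : List α}
    {y z u w t : α} (hhead : ∀ c, [c] <+: C → ¬ N c) (hlast : ∀ c, [c] <:+ C → ¬ N c)
    (h : [u, w, t] <:+: y :: (C ++ [z])) (hw : N w) :
    ∃ S T, C = S ++ u :: w :: t :: T := by
  obtain ⟨S, T, hST⟩ := h
  rcases S with _ | ⟨s, S⟩
  · rcases C with _ | ⟨c, C⟩
    · simp at hST
    · simp only [List.nil_append, List.cons_append, List.cons.injEq] at hST
      exact absurd hw (hST.2.1 ▸ hhead c (by simp))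
  · rcases List.eq_nil_or_concat T with rfl | ⟨T, t', rfl⟩
    · exfalso
      have h2 : S ++ [u, w] = C ∧ t = z := by
        have : (S ++ [u, w]) ++ [t] = C ++ [z] := by simpa using (List.cons.inj hST).2
        exact ⟨(List.append_inj' this rfl).1, by simpa using (List.append_inj' this rfl).2⟩
      exact hlast w (h2.1 ▸ ⟨S ++ [u], by simp⟩) hw
    · refine ⟨S, T, ?_⟩
      have : (S ++ u :: w :: t :: T) ++ [t'] = C ++ [z] := by simpa using (List.cons.inj hST).2
      exact (List.append_inj' this rfl).1.symm

namespace IsCritical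

lemma not_isCycleWith (hcr : IsCritical G v ℓ δ x) (m : ℕ) :
    ∀ A B C : List V, C.length = m → A ≠ [] → B ≠ [] → (∀ a ∈ A, G.Adj v a) →
      (∀ b ∈ B, G.Adj v b) → ¬ IsCycleWith G v δ x (A ++ (C ++ B)) := by
  classical
  induction m using Nat.strong_induction_on with
  | _ m ih =>
  intro A B C hCm hA0 hB0 hA hB h
  subst hCm
  have hhead : ∀ c, [c] <+: C → ¬ G.Adj v c := by
    rintro c ⟨C', rfl⟩ hc
    refine ih C'.length (by simp) (A ++ [c]) B C' rfl (by simp) hB0 ?_ hB (by simpa using h)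
    simpa [or_imp, forall_and] using And.intro hA hc
  have hlast : ∀ c, [c] <:+ C → ¬ G.Adj v c := by
    rintro c ⟨C', rfl⟩ hc
    refine ih C'.length (by simp) A (c :: B) C' rfl hA0 (by simp) hA ?_ (by simpa using h)
    simpa using And.intro hc hB
  have hex := hcr.exists_adj_core h hA0 hB0 hA hB
  have hle := hcr.length_add_length_le h hA0 hB0 hA hB
  obtain ⟨h1, h2⟩ := countP_core h hA hB
  obtain ⟨p, A₁, rfl⟩ := List.exists_cons_of_ne_nil hA0
  obtain ⟨B₁, q, rfl⟩ := (List.eq_nil_or_concat' B).resolve_left hB0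
  obtain ⟨A₂, y₀, hy₀⟩ := (List.eq_nil_or_concat' (p :: A₁)).resolve_left hA0
  obtain ⟨z₀, B₂, hz₀⟩ := List.exists_cons_of_ne_nil hB0
  have hvp : G.Adj v p := hA p (by simp)
  have hvq : G.Adj v q := hB q (by simp)
  have hp : (p :: A₁) ++ (C ++ (B₁ ++ [q])) = p :: (A₁ ++ (C ++ (B₁ ++ [q]))) := rfl
  have hq : (p :: A₁) ++ (C ++ (B₁ ++ [q])) = ((p :: A₁) ++ (C ++ B₁)) ++ [q] := by simp
  have hpq := hcr.not_adj_ends h hp hq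
  have hnd := (List.nodup_cons.1 h.cycle.2).2
  have hne : p ≠ q := by
    rintro rfl
    simp at hnd
  have hsub : ∀ Y, Y <:+: y₀ :: (C ++ [z₀]) →
      ∃ S T, (p :: A₁) ++ (C ++ (B₁ ++ [q])) = S ++ (Y ++ T) := by
    rintro Y ⟨S, T, hST⟩
    refine ⟨A₂ ++ S, T ++ B₂, ?_⟩
    rw [hy₀, hz₀]
    calc (A₂ ++ [y₀]) ++ (C ++ z₀ :: B₂) = A₂ ++ (y₀ :: (C ++ [z₀]) ++ B₂) := by simp
      _ = _ := by rw [← hST]; simp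
  have hdisj : ∀ y, FarNeighbor G v q y → ¬ FarNeighbor G v p y := fun y =>
    FarNeighbor.not_of_not_adj hcr.clawFree hvp hvq hne hpq
  have hℓ := hcr.le_add
  have hW : RunWord (G.Adj v) (FarNeighbor G v q) (FarNeighbor G v p) (δ + x + 1 - ℓ)
      (y₀ :: (C ++ [z₀])) := by
    refine ⟨hdisj, ?_, ?_, ?_, ?_⟩
    · intro y z hyz hy hz
      obtain ⟨S, T, hST⟩ := hsub _ hyz
      exact hcr.farNeighbor_or h hp hq (W := []) (S := S) (T := T) (by simpa using hST) hy hz rfl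
    · intro y W z hyz hy hz hW hWN hWr
      obtain ⟨S, T, hST⟩ := hsub _ hyz
      exact hcr.farNeighbor_and_of_gap h hp hq (W := W) (S := S) (T := T) (by simpa using hST)
        hy hz hW hWN (by omega)
    · intro hr y w z hyz hy _ hz
      obtain ⟨S, T, hST⟩ := hsub _ hyz
      exact hcr.farNeighbor_and_of_length h hp hq (W := [w]) (S := S) (T := T)
        (by simpa using hST) hy hz (by simp; omega)
    · intro u w t huwt hw hcase
      obtain ⟨S, T, rfl⟩ := exists_eq_append_of_infix_cons_concat hhead hlast huwt hw
      have hut : u ≠ t := by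
        rintro rfl
        simp [List.nodup_append] at hnd
      have hadj : G.Adj u t := by
        rcases hcase with ⟨hu, ht⟩ | ⟨hu, ht⟩ | ⟨hu, ht⟩
        · have hch : [u, w, t].IsChain G.Adj := by
            have hc := ((isCycleThrough_iff (by simp)).1 h.cycle).1
            exact hc.infix ⟨(p :: A₁) ++ S, T ++ (B₁ ++ [q]), by simp⟩
          simp only [List.isChain_cons_cons, List.isChain_singleton, and_true] at hch
          by_contra hnut
          refine hcr.clawFree w u t v hch.1.symm hch.2 hw.symm hut ?_ ?_ hnut
            (fun h => hu h.symm) (fun h => ht h.symm)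
          · rintro rfl
            exact (List.nodup_cons.1 h.cycle.2).1 (by simp)
          · rintro rfl
            exact (List.nodup_cons.1 h.cycle.2).1 (by simp)
        · exact hu.adj hcr.clawFree hvq ht hut
        · exact hu.adj hcr.clawFree hvp ht hut
      obtain ⟨A, B, hA', hB', hA'', hB'', h'⟩ := h.exists_relocate hA hB hw hadj
        (Classical.not_and_iff_not_or_not.1 fun hh => hdisj w hh.1 hh.2)
      exact ih _ (by simp) A B _ rfl hA' hB' hA'' hB'' h'
  have hy₀N : G.Adj v y₀ := hA y₀ (by simp [hy₀])
  have hz₀N : G.Adj v z₀ := hB z₀ (by simp [hz₀])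
  have hcore := RunWord.countP_core_le (by omega) hW hy₀N hz₀N hhead hlast hex
  have hlt := hcr.lt_count
  have hA1 := List.length_pos_iff.2 hA0
  have hB1 := List.length_pos_iff.2 hB0
  omega

end IsCritical

lemma IsCycleWith.hasCycleLength_of_clawFree (hclaw : ClawFree G) (hℓ3 : 3 ≤ ℓ) :
    ∀ {x : ℕ} {P : List V}, IsCycleWith G v δ x P → 2 * x < δ → ℓ ≤ δ + x + 1 →
      HasCycleLength G ℓ := by
  intro x
  induction x using Nat.strong_induction_on with
  | _ x ih =>
  intro P h hx hℓ
  have hl := h.length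
  rcases hℓ.eq_or_lt with rfl | hlt
  · exact hl ▸ h.cycle.hasCycleLength (by omega)
  by_contra hno
  have hcr : IsCritical G v ℓ δ x :=
    ⟨hclaw, hℓ3, by omega, hx, hno, fun y Q hy hQ => by
      by_contra! hle
      exact hno (ih y hy hQ (by omega) hle)⟩
  have hne : P ≠ [] := by
    rintro rfl
    simp at hl
    omega
  obtain ⟨-, -, hhead, hlast⟩ := (isCycleThrough_iff hne).1 h.cycle
  obtain ⟨p, P, rfl⟩ := List.exists_cons_of_ne_nil hne
  rcases List.eq_nil_or_concat' P with rfl | ⟨C, q, rfl⟩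
  · simp at hl
    omega
  · refine hcr.not_isCycleWith C.length [p] [q] C rfl (by simp) (by simp) ?_ ?_ h
    · simpa using hhead
    · simpa [List.getLast?_cons] using hlast

end Main

/-- A cycle through all vertices, as a list. -/
lemma exists_isCycleThrough {V : Type*} {G : SimpleGraph V} {v : V} {w : G.Walk v v}
    (hw : w.IsCycle) (hall : ∀ a, a ∈ w.support) :
    ∃ P : List V, IsCycleThrough G v P ∧ ∀ a, a ≠ v → a ∈ P := by
  have hchain := w.isChain_adj_support
  have hnd := hw.support_nodup
  have hne : w.support.tail ≠ [] := by
    have h3 := hw.three_le_length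
    have hl := w.length_support
    intro h0
    have := congrArg List.length h0
    rw [List.length_tail, List.length_nil] at this
    omega
  have hlast : w.support.tail.getLast hne = v := by
    rw [List.getLast_tail, SimpleGraph.Walk.getLast_support]
  have hsupp : w.support = v :: (w.support.tail.dropLast ++ [v]) := by
    have hd := List.dropLast_append_getLast hne
    rw [hlast] at hd
    rw [hd]
    exact w.cons_tail_support.symm
  set P := w.support.tail.dropLast
  rw [hsupp] at hchain hnd hall
  refine ⟨P, ⟨hchain, ?_⟩, fun a ha => ?_⟩
  · exact hnd.perm (List.perm_append_singleton v P)
  · simpa [ha] using hall a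

/-- If `G` is a claw-free hamiltonian graph of order `n` and maximum degree `Δ` with
`Δ ≥ 3` and `⌈(3/2)Δ⌉ ≥ n`, then `G` is pancyclic.
(Note `⌈(3/2)Δ⌉ = (3 * Δ + 1) / 2` in natural number arithmetic.) -/
theorem pancyclic_of_claw_free_hamiltonian_large_degree {V : Type*} [Fintype V]
    [DecidableEq V] (G : SimpleGraph V) [DecidableRel G.Adj] (n Δ : ℕ)
    (hn : n = Fintype.card V) (hΔ : Δ = G.maxDegree)
    (hclaw : ClawFree G)
    (hham : ∃ (v : V) (w : G.Walk v v), w.IsCycle ∧ ∀ x : V, x ∈ w.support)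
    (hΔ3 : 3 ≤ Δ) (hbig : n ≤ (3 * Δ + 1) / 2) :
    ∀ ℓ : ℕ, 3 ≤ ℓ → ℓ ≤ n → HasCycleLength G ℓ := by
  classical
  intro ℓ hℓ3 hℓn
  obtain ⟨u, w, hw, hall⟩ := hham
  have : Nonempty V := ⟨u⟩
  obtain ⟨v, hv⟩ := G.exists_maximal_degree_vertex
  have hc := hw.rotate (hall v)
  have hmem : ∀ a, a ∈ (w.rotate v (hall v)).support := fun a => by
    rw [SimpleGraph.Walk.mem_support_rotate_iff]
    exact hall a
  obtain ⟨P, hP, hcov⟩ := exists_isCycleThrough hc hmem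
  have hnd := (List.nodup_cons.1 hP.2)
  have hN : P.countP (fun a => G.Adj v a) = Δ := by
    rw [hΔ, hv, ← G.card_neighborFinset_eq_degree, List.countP_eq_length_filter,
      ← List.toFinset_card_of_nodup (hnd.2.filter _)]
    congr 1
    ext a
    simp only [List.mem_toFinset, List.mem_filter, decide_eq_true_eq,
      SimpleGraph.mem_neighborFinset, and_iff_right_iff_imp]
    exact fun ha => hcov a ha.ne'
  have hlen : P.length + 1 = n := by
    rw [hn, ← List.length_cons (a := v), ← List.toFinset_card_of_nodup hP.2,
      ← Finset.card_univ]
    congr 1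
    ext a
    simpa [or_iff_not_imp_left] using hcov a
  have hsum := length_eq_countP_adj_add G v P
  have hW : IsCycleWith G v Δ (P.countP (fun a => ¬ G.Adj v a)) P :=
    ⟨hP, by convert hN, by congr!⟩
  have hN' := hW.length
  exact hW.hasCycleLength_of_clawFree hclaw hℓ3 (by omega) (by omega)
end

section
/- Let G be a graph of order n with a hamiltonian cycle v₀v₁…v_{n−1}v₀ in which d_G(v₀) + d_G(v₁) ≥ n. Then G is pancyclic, or G is bipartite, or G has cycles of every length ℓ with 3 ≤ ℓ ≤ n except ℓ = n − 1. Moreover, if d_G(v₀) + d_G(v₁) > n, then G is pancyclic. -/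
/-- Two sets of chord ends `A`, `B` on the path `1, …, n`, from its first and its last vertex
respectively, that create no cycle of length `t + 2` while every position of a Bondy-type pairing
carries a chord. -/
structure ChordPattern (n t : ℕ) (A B : ℕ → Prop) : Prop where
  one_le : 1 ≤ t
  add_four_le : t + 4 ≤ n
  fst_two : A 2
  snd_last : B (n - 1)
  not_fst_snd : ∀ i k, 2 ≤ i → i ≤ n - 1 → 2 ≤ k → k ≤ n - 1 →
    (i - k) + (k - i) + 1 = t → A i → ¬ B k
  not_fst_fst : ∀ i, 2 ≤ i → i + t ≤ n - 1 → A i → ¬ A (i + t)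
  not_snd_snd : ∀ i, 2 ≤ i → i + t ≤ n - 1 → B i → ¬ B (i + t)
  not_four : ∀ i k p q, 2 ≤ i → 2 ≤ k → i < p → i < q → k < p → k < q → p ≤ n - 1 → q ≤ n - 1 →
    (i - k) + (k - i) + ((p - q) + (q - p)) + 2 = t → A i → B k → B p → ¬ A q
  fst_or_snd : ∀ j, 2 ≤ j → j + t ≤ n → A j ∨ B (j + t - 1)
  fst_or_snd_wrap : ∀ k, 2 ≤ k → k ≤ t → A (k + n - t - 1) ∨ B k

lemma exists_last_before_not {P : ℕ → Prop} {a N : ℕ} (haN : a ≤ N) (ha : P a) (hN : ¬ P N) :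
    ∃ x, a ≤ x ∧ x < N ∧ P x ∧ ¬ P (x + 1) := by
  by_contra! h
  exact hN (Nat.le_induction (P := fun m _ => m ≤ N → P m) (fun _ => ha)
    (fun m ham ih hm => h m ham hm (ih (by omega))) N haN le_rfl)

namespace ChordPattern

variable {n t : ℕ} {A B : ℕ → Prop}

lemma reflect (h : ChordPattern n t A B) :
    ChordPattern n t (fun i => B (n + 1 - i)) (fun i => A (n + 1 - i)) := by
  have ht := h.one_le
  have hn := h.add_four_le
  refine ⟨ht, hn, ?_, ?_, ?_, ?_, ?_, ?_, ?_, ?_⟩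
  · exact h.snd_last
  · have : n + 1 - (n - 1) = 2 := by omega
    simpa only [this] using h.fst_two
  · intro i k _ _ _ _ _ hi hk
    exact h.not_fst_snd _ _ (by omega) (by omega) (by omega) (by omega) (by omega) hk hi
  · intro i _ _ hi hit
    refine h.not_snd_snd (n + 1 - (i + t)) (by omega) (by omega) hit ?_
    have : n + 1 - (i + t) + t = n + 1 - i := by omega
    rwa [this]
  · intro i _ _ hi hit
    refine h.not_fst_fst (n + 1 - (i + t)) (by omega) (by omega) hit ?_
    have : n + 1 - (i + t) + t = n + 1 - i := by omega
    rwa [this]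
  · intro i k p q _ _ _ _ _ _ _ _ _ hi hk hp hq
    exact h.not_four (n + 1 - p) (n + 1 - q) (n + 1 - i) (n + 1 - k) (by omega) (by omega)
      (by omega) (by omega) (by omega) (by omega) (by omega) (by omega) (by omega) hp hq hi hk
  · intro j _ _
    have e : n + 1 - j = (n + 1 - (j + t - 1)) + t - 1 := by omega
    have := h.fst_or_snd (n + 1 - (j + t - 1)) (by omega) (by omega)
    rw [← e] at this
    exact this.symm
  · intro k _ _
    have e : n + 1 - k = (n + 1 - (k + n - t - 1)) + n - t - 1 := by omega
    have := h.fst_or_snd_wrap (n + 1 - (k + n - t - 1)) (by omega) (by omega)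
    rw [← e] at this
    exact this.symm

lemma not_snd_two (h : ChordPattern n t A B) : ¬ B 2 := by
  intro hB
  have ht := h.one_le
  have hn := h.add_four_le
  have hN : ¬ A (min (t + 1) (n - t)) := by
    rcases min_choice (t + 1) (n - t) with e | e <;> rw [e] <;> intro hA
    · exact h.not_fst_snd (t + 1) 2 (by omega) (by omega) (by omega) (by omega) (by omega) hA hB
    · exact h.not_fst_snd (n - t) (n - 1) (by omega) (by omega) (by omega) (by omega) (by omega)
        hA h.snd_last
  obtain ⟨x, hx2, hxN, hx, hx1⟩ := exists_last_before_not (by omega) h.fst_two hN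
  have hBxt : B (x + t) := by
    have := (h.fst_or_snd (x + 1) (by omega) (by omega)).resolve_left hx1
    rwa [show x + 1 + t - 1 = x + t by omega] at this
  have hBx : ¬ B x := fun hBx => h.not_snd_snd x hx2 (by omega) hBx hBxt
  have hq := (h.fst_or_snd_wrap x hx2 (by omega)).resolve_right hBx
  exact h.not_four x 2 (n - 1) (x + n - t - 1) hx2 le_rfl (by omega) (by omega) (by omega)
    (by omega) le_rfl (by omega) (by omega) hx hB h.snd_last hq

lemma not_fst_last (h : ChordPattern n t A B) : ¬ A (n - 1) := h.reflect.not_snd_two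

/-- A chord from the first vertex to `j` lets the chords near the end repeat with period
`j - 2`. -/
lemma fst_step (h : ChordPattern n t A B) {i j : ℕ} (hj3 : 3 ≤ j) (hjn : j + t ≤ n) (hj : A j)
    (hi1 : 1 ≤ i) (hij : i + j - 1 ≤ t) (hi : A (n - t + i)) : A (n - t + i + (j - 2)) := by
  have hn := h.add_four_le
  rcases h.fst_or_snd_wrap (i + j - 1) (by omega) hij with hA | hB
  · rwa [show i + j - 1 + n - t - 1 = n - t + i + (j - 2) by omega] at hA
  · exact absurd hi (h.not_four j (i + j - 1) (n - 1) (n - t + i) (by omega) (by omega) (by omega)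
      (by omega) (by omega) (by omega) le_rfl (by omega) (by omega) hj hB h.snd_last)

lemma fst_near_end (h : ChordPattern n t A B) (ht : 2 ≤ t) : A (n - t + 1) := by
  have hn := h.add_four_le
  have := (h.fst_or_snd_wrap 2 le_rfl ht).resolve_right h.not_snd_two
  rwa [show 2 + n - t - 1 = n - t + 1 by omega] at this

lemma fst_chain (h : ChordPattern n t A B) {i j : ℕ} (hj3 : 3 ≤ j) (hjn : j + t ≤ n) (hj : A j)
    (hi1 : 1 ≤ i) (hi : A (n - t + i)) (s : ℕ) (hs : i + s * (j - 2) ≤ t - 1) :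
    A (n - t + (i + s * (j - 2))) := by
  induction s with
  | zero => simpa using hi
  | succ s ih =>
    rw [Nat.succ_mul] at hs ⊢
    have := h.fst_step (i := i + s * (j - 2)) hj3 hjn hj (by omega) (by omega) (ih (by omega))
    rwa [show n - t + (i + (s * (j - 2) + (j - 2))) = n - t + (i + s * (j - 2)) + (j - 2) by omega]

lemma not_fst_three (h : ChordPattern n t A B) : ¬ A 3 := by
  intro hA
  have ht := h.one_le
  have hn := h.add_four_le
  obtain rfl | ht2 : t = 1 ∨ 2 ≤ t := by omega
  · exact h.not_fst_fst 2 le_rfl (by omega) h.fst_two hA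
  · have := h.fst_chain (j := 3) le_rfl (by omega) hA le_rfl (h.fst_near_end ht2) (t - 2) (by omega)
    rw [show n - t + (1 + (t - 2) * (3 - 2)) = n - 1 by omega] at this
    exact h.not_fst_last this

lemma not_snd_next_to_last (h : ChordPattern n t A B) : ¬ B (n - 2) := by
  have hn := h.add_four_le
  have := h.reflect.not_fst_three
  rwa [show n + 1 - 3 = n - 2 by omega] at this

lemma fst_four (h : ChordPattern n t A B) : A 4 := by
  have ht := h.one_le
  have hn := h.add_four_le
  have hex : ∃ j, 3 ≤ j ∧ A j := by
    refine ⟨n - t - 1, by omega, (h.fst_or_snd _ (by omega) (by omega)).resolve_right ?_⟩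
    rw [show n - t - 1 + t - 1 = n - 2 by omega]
    exact h.not_snd_next_to_last
  classical
  obtain ⟨j, hj, hjmin⟩ : ∃ j, (3 ≤ j ∧ A j) ∧ ∀ m < j, ¬ (3 ≤ m ∧ A m) :=
    ⟨Nat.find hex, Nat.find_spec hex, fun m hm => Nat.find_min hex hm⟩
  obtain ⟨hj3, hAj⟩ := hj
  have hjn : j ≤ n - t - 1 := by
    by_contra hlt
    refine hjmin (n - t - 1) (by omega) ⟨by omega, ?_⟩
    refine (h.fst_or_snd _ (by omega) (by omega)).resolve_right ?_
    rw [show n - t - 1 + t - 1 = n - 2 by omega]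
    exact h.not_snd_next_to_last
  have hj4 : j ≠ 3 := fun e => h.not_fst_three (e ▸ hAj)
  by_cases hj5 : j = 4
  · exact hj5 ▸ hAj
  exfalso
  have hB : ∀ m, 3 ≤ m → m < j → B (m + t - 1) := fun m h3 hm =>
    (h.fst_or_snd m (by omega) (by omega)).resolve_left fun hA => hjmin m hm ⟨h3, hA⟩
  have hnB : ∀ m, 2 ≤ m → m + 2 ≤ j → ¬ B m := by
    intro m h2 hm hBm
    have := hB (m + 1) (by omega) (by omega)
    rw [show m + 1 + t - 1 = m + t by omega] at this
    exact h.not_snd_snd m h2 (by omega) hBm this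
  obtain rfl | ht2 : t = 1 ∨ 2 ≤ t := by omega
  · exact hnB 3 (by omega) (by omega) (hB 3 le_rfl (by omega))
  have hall : ∀ i, i ≤ t - 1 → i % (j - 2) ≠ 0 → A (n - t + i) := by
    intro i hit hi
    have hlt := Nat.mod_lt i (show 0 < j - 2 by omega)
    have hdm := Nat.mod_add_div i (j - 2)
    rw [Nat.mul_comm] at hdm
    have hbase : A (n - t + i % (j - 2)) := by
      have := (h.fst_or_snd_wrap (i % (j - 2) + 1) (by omega) (by omega)).resolve_right
        (hnB _ (by omega) (by omega))
      rwa [show i % (j - 2) + 1 + n - t - 1 = n - t + i % (j - 2) by omega] at this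
    have := h.fst_chain hj3 (by omega) hAj (by omega) hbase (i / (j - 2)) (by omega)
    rwa [hdm] at this
  have hmod : (t - 1) % (j - 2) = 0 := by
    by_contra hne
    have := hall (t - 1) le_rfl hne
    rw [show n - t + (t - 1) = n - 1 by omega] at this
    exact h.not_fst_last this
  have hle : j - 2 ≤ t - 1 := Nat.le_of_dvd (by omega) (Nat.dvd_of_mod_eq_zero hmod)
  have hne : (t - 2) % (j - 2) ≠ 0 := by
    intro h0
    have := (Nat.dvd_sub (Nat.dvd_of_mod_eq_zero hmod) (Nat.dvd_of_mod_eq_zero h0))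
    rw [show t - 1 - (t - 2) = 1 by omega, Nat.dvd_one] at this
    omega
  have hA2 := hall (t - 2) (by omega) hne
  rw [show n - t + (t - 2) = n - 2 by omega] at hA2
  have hBk := hB (j - 2) (by omega) (by omega)
  exact h.not_four j (j - 2 + t - 1) (n - 1) (n - 2) (by omega) (by omega) (by omega) (by omega)
    (by omega) (by omega) le_rfl (by omega) (by omega) hAj hBk h.snd_last hA2

/-- The ends of the chords alternate along the path. -/
theorem alternating (h : ChordPattern n t A B) :
    Even n ∧ Odd t ∧ ∀ j, 2 ≤ j → j ≤ n - 1 → (A j ↔ Even j) ∧ (B j ↔ Odd j) := by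
  have ht := h.one_le
  have hn := h.add_four_le
  have hnB2 := h.not_snd_two
  have hlast := h.not_fst_last
  obtain rfl | ht2 : t = 1 ∨ 2 ≤ t := by omega
  · have hiff : ∀ j, 2 ≤ j → j ≤ n - 1 → (A j ↔ ¬ B j) := fun j h2 hj =>
      ⟨h.not_fst_snd j j h2 hj h2 hj (by omega),
        (h.fst_or_snd j h2 (by omega)).resolve_right⟩
    have hA : ∀ j, 2 ≤ j → j ≤ n - 1 → (A j ↔ Even j) := by
      intro j h2
      induction j, h2 using Nat.le_induction with
      | base => exact fun _ => by simp [h.fst_two]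
      | succ j h2 ih =>
        intro hj
        have h1 := h.not_fst_fst j h2 hj
        have h3 := h.not_snd_snd j h2 hj
        have h4 := hiff j h2 (by omega)
        have h5 := hiff (j + 1) (by omega) hj
        have h6 := ih (by omega)
        rw [Nat.even_add_one]
        tauto
    have hB : ∀ j, 2 ≤ j → j ≤ n - 1 → (B j ↔ Odd j) := fun j h2 hj => by
      rw [← Nat.not_even_iff_odd, ← hA j h2 hj, hiff j h2 hj, not_not]
    refine ⟨?_, odd_one, fun j h2 hj => ⟨hA j h2 hj, hB j h2 hj⟩⟩
    have := (hB (n - 1) (by omega) le_rfl).1 h.snd_last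
    rw [Nat.odd_iff] at this
    rw [Nat.even_iff]
    omega
  have hA4 := h.fst_four
  have hchain : ∀ i s, 1 ≤ i → A (n - t + i) → i + s * 2 ≤ t - 1 → A (n - t + (i + s * 2)) :=
    fun i s h1 hi hs => h.fst_chain (j := 4) (by omega) (by omega) hA4 h1 hi s hs
  have hA1 := h.fst_near_end ht2
  have htodd : t % 2 = 1 := by
    by_contra hev
    have := hchain 1 (t / 2 - 1) le_rfl hA1 (by omega)
    rw [show n - t + (1 + (t / 2 - 1) * 2) = n - 1 by omega] at this
    exact hlast this
  have hend : ∀ i, 1 ≤ i → i ≤ t - 1 → (A (n - t + i) ↔ i % 2 = 1) := by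
    intro i h1 hi
    constructor
    · intro hA
      by_contra hev
      have := hchain i ((t - 1 - i) / 2) h1 hA (by omega)
      rw [show n - t + (i + (t - 1 - i) / 2 * 2) = n - 1 by omega] at this
      exact hlast this
    · intro hodd
      have := hchain 1 (i / 2) le_rfl hA1 (by omega)
      rwa [show 1 + i / 2 * 2 = i by omega] at this
  have hB3 : B 3 := by
    refine (h.fst_or_snd_wrap 3 (by omega) (by omega)).resolve_left ?_
    rw [show 3 + n - t - 1 = n - t + 2 by omega, hend 2 (by omega) (by omega)]
    omega
  have hup : ∀ p s, t + 1 ≤ p → B p → p + s * 2 ≤ n - 1 → B (p + s * 2) := by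
    intro p s hp hBp hs
    induction s with
    | zero => simpa using hBp
    | succ s ih =>
      rcases h.fst_or_snd (p + s * 2 - t + 3) (by omega) (by omega) with hA | hB
      · exact absurd hA (h.not_four 2 3 (p + s * 2) (p + s * 2 - t + 3) le_rfl (by omega) (by omega)
          (by omega) (by omega) (by omega) (by omega) (by omega) (by omega) h.fst_two hB3
          (ih (by omega)))
      · rwa [show p + s * 2 - t + 3 + t - 1 = p + (s + 1) * 2 by omega] at hB
  have hBt : B (t + 2) := by
    have := (h.fst_or_snd 3 (by omega) (by omega)).resolve_left h.not_fst_three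
    rwa [show 3 + t - 1 = t + 2 by omega] at this
  have hpar : ∀ p, t + 1 ≤ p → p ≤ n - 1 → B p → p % 2 = (n - 1) % 2 := by
    intro p hp hpn hBp
    by_contra hne
    have := hup p ((n - 2 - p) / 2) hp hBp (by omega)
    rw [show p + (n - 2 - p) / 2 * 2 = n - 2 by omega] at this
    exact h.not_snd_next_to_last this
  have hneven : n % 2 = 0 := by
    have := hpar (t + 2) (by omega) (by omega) hBt
    omega
  have hBhigh : ∀ p, t + 1 ≤ p → p ≤ n - 1 → (B p ↔ p % 2 = 1) := by
    refine fun p hp hpn => ⟨fun hBp => ?_, fun hodd => ?_⟩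
    · have := hpar p hp hpn hBp
      omega
    · have := hup (t + 2) ((p - t - 2) / 2) (by omega) hBt (by omega)
      rwa [show t + 2 + (p - t - 2) / 2 * 2 = p by omega] at this
  refine ⟨Nat.even_iff.2 hneven, Nat.odd_iff.2 htodd, fun j h2 hj => ⟨?_, ?_⟩⟩
  · rw [Nat.even_iff]
    by_cases hjt : j + t ≤ n
    · have h1 := hBhigh (j + t - 1) (by omega) (by omega)
      have h3 : A j → ¬ B (j + t - 1) :=
        h.not_fst_snd j (j + t - 1) h2 hj (by omega) (by omega) (by omega)
      have h4 := h.fst_or_snd j h2 hjt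
      have h5 : (j + t - 1) % 2 = 1 ↔ ¬ j % 2 = 0 := by omega
      tauto
    · have := hend (j - (n - t)) (by omega) (by omega)
      rw [show n - t + (j - (n - t)) = j by omega] at this
      rw [this]
      omega
  · rw [Nat.odd_iff]
    by_cases hjt : t + 1 ≤ j
    · exact hBhigh j hjt hj
    · have h1 := hend (j - 1) (by omega) (by omega)
      have h3 : B j → ¬ A (j + n - t - 1) := fun hB =>
        h.not_four 2 j (n - 1) (j + n - t - 1) le_rfl h2 (by omega) (by omega) (by omega)
          (by omega) le_rfl (by omega) (by omega) h.fst_two hB h.snd_last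
      have h4 := h.fst_or_snd_wrap j h2 (by omega)
      rw [show j + n - t - 1 = n - t + (j - 1) by omega] at h3 h4
      have h5 : (j - 1) % 2 = 1 ↔ ¬ j % 2 = 1 := by omega
      tauto

end ChordPattern

/-- `u 1, …, u n, u 1` is a cycle of `G`. -/
structure IsCycleLabelling {V : Type*} (G : SimpleGraph V) (n : ℕ) (u : ℕ → V) : Prop where
  injOn : Set.InjOn u (Set.Icc 1 n)
  adj_succ : ∀ i, 1 ≤ i → i < n → G.Adj (u i) (u (i + 1))
  adj_last : G.Adj (u n) (u 1)

/-- The graph whose vertices are labelled by `u` has a path from `u i` to `u k` on `m` vertices,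
with distinct labels taken from `S`. -/
def HasLabelPath {V : Type*} (G : SimpleGraph V) (u : ℕ → V) (S : Set ℕ) (i k m : ℕ) : Prop :=
  ∃ L : List ℕ, L.Nodup ∧ L.IsChain (fun x y => G.Adj (u x) (u y)) ∧ L.head? = some i ∧
    L.getLast? = some k ∧ L.length = m ∧ ∀ x ∈ L, x ∈ S

lemma HasLabelPath.append {V : Type*} {G : SimpleGraph V} {u : ℕ → V} {S T : Set ℕ}
    {i k m p q l : ℕ} (h₁ : HasLabelPath G u S i k m) (h₂ : HasLabelPath G u T p q l)
    (hadj : G.Adj (u k) (u p)) (hST : Disjoint S T) :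
    HasLabelPath G u (S ∪ T) i q (m + l) := by
  obtain ⟨L, hnd, hch, hhd, hlast, hlen, hS⟩ := h₁
  obtain ⟨M, hnd', hch', hhd', hlast', hlen', hT⟩ := h₂
  refine ⟨L ++ M, ?_, ?_, ?_, ?_, ?_, ?_⟩
  · exact hnd.append hnd' fun x hx hx' => Set.disjoint_left.1 hST (hS x hx) (hT x hx')
  · refine List.isChain_append.2 ⟨hch, hch', ?_⟩
    simp [hlast, hhd', hadj]
  · simp [List.head?_append, hhd]
  · simp [List.getLast?_append, hlast']
  · simp [hlen, hlen']
  · simp only [List.mem_append, Set.mem_union]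
    exact fun x hx => hx.imp (hS x) (hT x)

lemma HasLabelPath.reverse {V : Type*} {G : SimpleGraph V} {u : ℕ → V} {S : Set ℕ} {i k m : ℕ}
    (h : HasLabelPath G u S i k m) : HasLabelPath G u S k i m := by
  obtain ⟨L, hnd, hch, hhd, hlast, hlen, hS⟩ := h
  refine ⟨L.reverse, List.nodup_reverse.2 hnd, ?_, by simpa, by simpa, by simpa, by simpa⟩
  rw [List.isChain_reverse]
  exact hch.imp fun _ _ h => h.symm

lemma HasLabelPath.hasCycleLength {V : Type*} {G : SimpleGraph V} {u : ℕ → V} {S : Set ℕ}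
    {i k m : ℕ} (h : HasLabelPath G u S i k m) (hu : Set.InjOn u S) (hadj : G.Adj (u k) (u i))
    (hm : 3 ≤ m) : HasCycleLength G m := by
  obtain ⟨L, hnd, hch, hhd, hlast, hlen, hS⟩ := h
  have hne : L ≠ [] := by rintro rfl; simp at hhd
  have hne' : L.map u ≠ [] := by simpa
  have hch' : (L.map u).IsChain G.Adj := by rwa [List.isChain_map]
  have hnd' : (L.map u).Nodup := List.Nodup.map_on (fun x hx y hy => hu (hS x hx) (hS y hy)) hnd
  have hadj' : G.Adj ((L.map u).getLast hne') ((L.map u).head hne') := by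
    have h1 : (L.map u).getLast hne' = u k := by
      rw [List.getLast?_eq_some_getLast hne] at hlast
      simp [Option.some.inj hlast]
    have h2 : (L.map u).head hne' = u i := by
      rw [List.head?_eq_some_head hne] at hhd
      simp [Option.some.inj hhd]
    rwa [h1, h2]
  have hpath : (SimpleGraph.Walk.ofSupport (L.map u) hne' hch').IsPath := by
    rw [SimpleGraph.Walk.isPath_def, SimpleGraph.Walk.support_ofSupport]
    exact hnd'
  have hwlen : (SimpleGraph.Walk.ofSupport (L.map u) hne' hch').length + 1 = m := by
    rw [← SimpleGraph.Walk.length_support, SimpleGraph.Walk.support_ofSupport, List.length_map,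
      hlen]
  refine ⟨_, .cons hadj' (.ofSupport (L.map u) hne' hch'), ?_, ?_⟩
  · refine (SimpleGraph.Walk.cons_isCycle_iff _ _).2 ⟨hpath, fun hmem => ?_⟩
    rw [Sym2.eq_swap] at hmem
    have := hpath.length_eq_one_of_mem_edges hmem
    omega
  · rw [SimpleGraph.Walk.length_cons, hwlen]

namespace IsCycleLabelling

variable {V : Type*} {G : SimpleGraph V} {n : ℕ} {u : ℕ → V}

lemma hasLabelPath_add (h : IsCycleLabelling G n u) {i : ℕ} (hi : 1 ≤ i) (d : ℕ) (hd : i + d ≤ n) :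
    HasLabelPath G u (Set.uIcc i (i + d)) i (i + d) (d + 1) := by
  induction d with
  | zero => exact ⟨[i], by simp⟩
  | succ d ih =>
    have h1 : HasLabelPath G u {i + (d + 1)} (i + (d + 1)) (i + (d + 1)) 1 :=
      ⟨[i + (d + 1)], by simp⟩
    obtain ⟨L, h2, h3, h4, h5, h6, h7⟩ := (ih (by omega)).append h1
      (h.adj_succ (i + d) (by omega) (by omega)) (by simp)
    refine ⟨L, h2, h3, h4, h5, h6, fun x hx => ?_⟩
    have := h7 x hx
    simp only [Set.union_singleton, Set.mem_insert_iff, Set.mem_uIcc] at this ⊢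
    omega

lemma hasLabelPath (h : IsCycleLabelling G n u) {i k m : ℕ} (hi : 1 ≤ i) (hin : i ≤ n)
    (hk : 1 ≤ k) (hkn : k ≤ n) (hm : (i - k) + (k - i) + 1 = m) :
    HasLabelPath G u (Set.uIcc i k) i k m := by
  rcases le_total i k with hik | hik
  · obtain ⟨d, rfl⟩ := Nat.exists_eq_add_of_le hik
    convert h.hasLabelPath_add hi d hkn using 1
    omega
  · obtain ⟨d, rfl⟩ := Nat.exists_eq_add_of_le hik
    rw [Set.uIcc_comm]
    convert (h.hasLabelPath_add hk d hin).reverse using 1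
    omega

lemma reflect (h : IsCycleLabelling G n u) :
    IsCycleLabelling G n (fun i => u (n + 1 - i)) := by
  refine ⟨fun i hi j hj e => ?_, fun i hi hin => ?_, ?_⟩
  · have := h.injOn ⟨by grind, by grind⟩ ⟨by grind, by grind⟩ e
    grind
  · have := h.adj_succ (n + 1 - (i + 1)) (by omega) (by omega)
    rw [show n + 1 - (i + 1) + 1 = n + 1 - i by omega] at this
    exact this.symm
  · simpa [show n + 1 - n = 1 by omega] using h.adj_last.symm

/-- The cycle `1, i, …, k, n`. -/
lemma hasCycleLength_of_fst_snd (h : IsCycleLabelling G n u) {i k m : ℕ} (hi : 2 ≤ i)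
    (hin : i ≤ n - 1) (hk : 2 ≤ k) (hkn : k ≤ n - 1) (hm : (i - k) + (k - i) + 3 = m)
    (hAi : G.Adj (u 1) (u i)) (hBk : G.Adj (u n) (u k)) : HasCycleLength G m := by
  have p₁ := h.hasLabelPath (i := 1) (k := 1) le_rfl (by omega) le_rfl (by omega) rfl
  have p₂ := h.hasLabelPath (i := i) (k := k) (by omega) (by omega) (by omega) (by omega) rfl
  have p₃ := h.hasLabelPath (i := n) (k := n) (by omega) le_rfl (by omega) le_rfl rfl
  have := ((p₁.append p₂ hAi ?_).append p₃ hBk.symm ?_).hasCycleLength (h.injOn.mono ?_)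
    h.adj_last (by omega)
  · convert this using 1
    omega
  all_goals
    simp only [Set.disjoint_left, Set.subset_def, Set.mem_union, Set.mem_uIcc, Set.mem_Icc]
    omega

/-- The cycle `1, i, …, k`. -/
lemma hasCycleLength_of_fst_fst (h : IsCycleLabelling G n u) {i k m : ℕ} (hi : 2 ≤ i)
    (hik : i < k) (hkn : k ≤ n) (hm : (k - i) + 2 = m)
    (hAi : G.Adj (u 1) (u i)) (hAk : G.Adj (u 1) (u k)) : HasCycleLength G m := by
  have p₁ := h.hasLabelPath (i := 1) (k := 1) le_rfl (by omega) le_rfl (by omega) rfl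
  have p₂ := h.hasLabelPath (i := i) (k := k) (by omega) (by omega) (by omega) (by omega) rfl
  have := (p₁.append p₂ hAi ?_).hasCycleLength (h.injOn.mono ?_) hAk.symm (by omega)
  · convert this using 1
    omega
  all_goals
    simp only [Set.disjoint_left, Set.subset_def, Set.mem_union, Set.mem_uIcc, Set.mem_Icc]
    omega

/-- The cycle `1, i, …, k, n, p, …, q`. -/
lemma hasCycleLength_of_four (h : IsCycleLabelling G n u) {i k p q m : ℕ} (hi : 2 ≤ i) (hk : 2 ≤ k)
    (hip : i < p) (hiq : i < q) (hkp : k < p) (hkq : k < q) (hpn : p ≤ n - 1) (hqn : q ≤ n - 1)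
    (hm : (i - k) + (k - i) + ((p - q) + (q - p)) + 4 = m)
    (hAi : G.Adj (u 1) (u i)) (hBk : G.Adj (u n) (u k)) (hBp : G.Adj (u n) (u p))
    (hAq : G.Adj (u 1) (u q)) : HasCycleLength G m := by
  have p₁ := h.hasLabelPath (i := 1) (k := 1) le_rfl (by omega) le_rfl (by omega) rfl
  have p₂ := h.hasLabelPath (i := i) (k := k) (by omega) (by omega) (by omega) (by omega) rfl
  have p₃ := h.hasLabelPath (i := n) (k := n) (by omega) le_rfl (by omega) le_rfl rfl
  have p₄ := h.hasLabelPath (i := p) (k := q) (by omega) (by omega) (by omega) (by omega) rfl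
  have := (((p₁.append p₂ hAi ?_).append p₃ hBk.symm ?_).append p₄ hBp ?_).hasCycleLength
    (h.injOn.mono ?_) hAq.symm (by omega)
  · convert this using 1
    omega
  all_goals
    simp only [Set.disjoint_left, Set.subset_def, Set.mem_union, Set.mem_uIcc, Set.mem_Icc]
    omega

/-- The cycle `1, i, …, p, q, …, m, n, …, r`. -/
lemma hasCycleLength_of_chord (h : IsCycleLabelling G n u) {i p q m r l : ℕ} (hi : 2 ≤ i)
    (hip : i ≤ p) (hpm : p < m) (hmq : m ≤ q) (hqr : q < r) (hrn : r ≤ n)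
    (hl : (p - i) + (q - m) + (n - r) + 4 = l)
    (hAi : G.Adj (u 1) (u i)) (hpq : G.Adj (u p) (u q)) (hBm : G.Adj (u n) (u m))
    (hAr : G.Adj (u 1) (u r)) : HasCycleLength G l := by
  have p₁ := h.hasLabelPath (i := 1) (k := 1) le_rfl (by omega) le_rfl (by omega) rfl
  have p₂ := h.hasLabelPath (i := i) (k := p) (by omega) (by omega) (by omega) (by omega) rfl
  have p₃ := h.hasLabelPath (i := q) (k := m) (by omega) (by omega) (by omega) (by omega) rfl
  have p₄ := h.hasLabelPath (i := n) (k := r) (by omega) (by omega) (by omega) (by omega) rfl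
  have := (((p₁.append p₂ hAi ?_).append p₃ hpq ?_).append p₄ hBm.symm ?_).hasCycleLength
    (h.injOn.mono ?_) hAr.symm (by omega)
  · convert this using 1
    omega
  all_goals
    simp only [Set.disjoint_left, Set.subset_def, Set.mem_union, Set.mem_uIcc, Set.mem_Icc]
    omega

/-- The triangle `1, p, q`. -/
lemma hasCycleLength_three (h : IsCycleLabelling G n u) {p q : ℕ} (hp : 2 ≤ p) (hpq : p < q)
    (hqn : q ≤ n) (hAp : G.Adj (u 1) (u p)) (hAq : G.Adj (u 1) (u q)) (hadj : G.Adj (u p) (u q)) :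
    HasCycleLength G 3 := by
  have p₁ := h.hasLabelPath (i := 1) (k := 1) le_rfl (by omega) le_rfl (by omega) rfl
  have p₂ := h.hasLabelPath (i := p) (k := p) (by omega) (by omega) (by omega) (by omega) rfl
  have p₃ := h.hasLabelPath (i := q) (k := q) (by omega) (by omega) (by omega) (by omega) rfl
  have := ((p₁.append p₂ hAp ?_).append p₃ hadj ?_).hasCycleLength (h.injOn.mono ?_) hAq.symm
    (by omega)
  · convert this using 1
    omega
  all_goals
    simp only [Set.disjoint_left, Set.subset_def, Set.mem_union, Set.mem_uIcc, Set.mem_Icc]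
    omega

lemma not_adj_of_even (h : IsCycleLabelling G n u) (hn : n % 2 = 0) {l : ℕ} (hl3 : 3 ≤ l)
    (hln : l ≤ n) (hlodd : l % 2 = 1) (hl : ¬ HasCycleLength G l)
    (hA : ∀ j, 2 ≤ j → j ≤ n - 1 → j % 2 = 0 → G.Adj (u 1) (u j))
    (hB : ∀ j, 2 ≤ j → j ≤ n - 1 → j % 2 = 1 → G.Adj (u n) (u j)) {p q : ℕ} (hp2 : 2 ≤ p)
    (hpq : p < q) (hqn : q ≤ n - 1) (hp : p % 2 = 0) (hq : q % 2 = 0) :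
    ¬ G.Adj (u p) (u q) := by
  intro hadj
  apply hl
  have hA' : ∀ j, 2 ≤ j → j ≤ n → j % 2 = 0 → G.Adj (u 1) (u j) := by
    intro j h2 hj hev
    obtain rfl | hlt : j = n ∨ j ≤ n - 1 := by omega
    · exact h.adj_last.symm
    · exact hA j h2 hlt hev
  obtain rfl | hl5 : l = 3 ∨ 5 ≤ l := by omega
  · exact h.hasCycleLength_three hp2 hpq (by omega) (hA p hp2 (by omega) hp)
      (hA q (by omega) hqn hq) hadj
  have hsum : ∃ x y z, x ≤ p / 2 - 1 ∧ y ≤ (q - p) / 2 - 1 ∧ z ≤ (n - q) / 2 - 1 ∧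
      2 * (x + y + z) + 5 = l := by
    refine ⟨min (p / 2 - 1) ((l - 5) / 2),
      min ((q - p) / 2 - 1) ((l - 5) / 2 - min (p / 2 - 1) ((l - 5) / 2)),
      (l - 5) / 2 - min (p / 2 - 1) ((l - 5) / 2) -
        min ((q - p) / 2 - 1) ((l - 5) / 2 - min (p / 2 - 1) ((l - 5) / 2)), ?_⟩
    omega
  obtain ⟨x, y, z, hx, hy, hz, hxyz⟩ := hsum
  exact h.hasCycleLength_of_chord (i := p - 2 * x) (m := q - 1 - 2 * y) (r := n - 2 * z)
    (by omega) (by omega) (by omega) (by omega) (by omega) (by omega) (by omega)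
    (hA' _ (by omega) (by omega) (by omega)) hadj (hB _ (by omega) (by omega) (by omega))
    (hA' _ (by omega) (by omega) (by omega))

end IsCycleLabelling

/-- The position paired with `j` when looking for a cycle of length `t + 2`: chords from the first
vertex to `j` and from the last vertex to `chordPartner n t j` would create such a cycle. -/
def chordPartner (n t j : ℕ) : ℕ := if j + t ≤ n then j + t - 1 else j + t + 1 - n

lemma image_chordPartner_filter {n t : ℕ} (ht : 1 ≤ t) (htn : t + 2 ≤ n) (B : ℕ → Prop)
    [DecidablePred B] :
    ({j ∈ Finset.Icc 2 (n - 1) | B (chordPartner n t j)}).image (chordPartner n t) =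
      {j ∈ Finset.Icc 2 (n - 1) | B j} := by
  ext k
  simp only [Finset.mem_image, Finset.mem_filter, Finset.mem_Icc]
  constructor
  · rintro ⟨j, ⟨⟨h2, hj⟩, hB⟩, rfl⟩
    refine ⟨?_, hB⟩
    unfold chordPartner
    split_ifs <;> omega
  · rintro ⟨⟨h2, hk⟩, hB⟩
    obtain ⟨j, hj, rfl⟩ : ∃ j, (2 ≤ j ∧ j ≤ n - 1) ∧ chordPartner n t j = k := by
      by_cases hkt : k ≤ t
      · refine ⟨k + n - t - 1, by omega, ?_⟩
        unfold chordPartner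
        split_ifs <;> omega
      · refine ⟨k + 1 - t, by omega, ?_⟩
        unfold chordPartner
        split_ifs <;> omega
    exact ⟨j, ⟨hj, hB⟩, rfl⟩

lemma injOn_chordPartner {n t : ℕ} (ht : 1 ≤ t) (htn : t + 2 ≤ n) :
    Set.InjOn (chordPartner n t) (Set.Icc 2 (n - 1)) := by
  rintro i ⟨hi, hi'⟩ j ⟨hj, hj'⟩ hij
  unfold chordPartner at hij
  split_ifs at hij <;> omega

/-- If no two paired positions both carry a chord, then there are at most `n - 2` chords, and when
this bound is attained each pair carries one. -/
lemma card_filter_chordPartner {n t : ℕ} (ht : 1 ≤ t) (htn : t + 2 ≤ n) (A B : ℕ → Prop)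
    [DecidablePred A] [DecidablePred B]
    (hAB : ∀ j, 2 ≤ j → j ≤ n - 1 → A j → ¬ B (chordPartner n t j)) :
    Finset.card {j ∈ Finset.Icc 2 (n - 1) | A j} +
        Finset.card {j ∈ Finset.Icc 2 (n - 1) | B j} ≤ n - 2 ∧
      (n - 2 ≤ Finset.card {j ∈ Finset.Icc 2 (n - 1) | A j} +
          Finset.card {j ∈ Finset.Icc 2 (n - 1) | B j} →
        ∀ j, 2 ≤ j → j ≤ n - 1 → A j ∨ B (chordPartner n t j)) := by
  have hdisj : Disjoint {j ∈ Finset.Icc 2 (n - 1) | A j}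
      {j ∈ Finset.Icc 2 (n - 1) | B (chordPartner n t j)} := by
    rw [Finset.disjoint_filter]
    intro j hj
    rw [Finset.mem_Icc] at hj
    exact hAB j hj.1 hj.2
  have hcard : (Finset.Icc 2 (n - 1)).card = n - 2 := by
    rw [Nat.card_Icc]
    omega
  rw [← image_chordPartner_filter ht htn B, Finset.card_image_of_injOn
    ((injOn_chordPartner ht htn).mono fun j hj => by simp at hj; exact hj.1),
    ← Finset.card_union_of_disjoint hdisj, ← Finset.filter_or, ← hcard]
  refine ⟨Finset.card_filter_le _ _, fun hle j h2 hj => ?_⟩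
  have := Finset.eq_of_subset_of_card_le (Finset.filter_subset _ _) hle
  exact Finset.filter_eq_self.1 this j (Finset.mem_Icc.2 ⟨h2, hj⟩)

namespace IsCycleLabelling

variable {V : Type*} {G : SimpleGraph V} {n : ℕ} {u : ℕ → V}

lemma adj_two (h : IsCycleLabelling G n u) (hn : 3 ≤ n) : G.Adj (u 1) (u 2) :=
  h.adj_succ 1 le_rfl (by omega)

lemma adj_next_to_last (h : IsCycleLabelling G n u) (hn : 3 ≤ n) : G.Adj (u n) (u (n - 1)) := by
  have := h.adj_succ (n - 1) (by omega) (by omega)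
  rw [show n - 1 + 1 = n by omega] at this
  exact this.symm

lemma hasCycleLength_self (h : IsCycleLabelling G n u) (hn : 3 ≤ n) : HasCycleLength G n :=
  h.hasCycleLength_of_fst_snd (i := 2) (k := n - 1) le_rfl (by omega) (by omega) le_rfl (by omega)
    (h.adj_two hn) (h.adj_next_to_last hn)

lemma degree_first [Fintype V] [DecidableRel G.Adj] (h : IsCycleLabelling G n u) (hn : 3 ≤ n)
    (hsurj : ∀ x, ∃ i, 1 ≤ i ∧ i ≤ n ∧ u i = x) :
    G.degree (u 1) = Finset.card {j ∈ Finset.Icc 2 (n - 1) | G.Adj (u 1) (u j)} + 1 := by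
  classical
  have : G.neighborFinset (u 1) =
      (insert n {j ∈ Finset.Icc 2 (n - 1) | G.Adj (u 1) (u j)}).image u := by
    ext x
    simp only [SimpleGraph.mem_neighborFinset, Finset.mem_image, Finset.mem_insert,
      Finset.mem_filter, Finset.mem_Icc]
    constructor
    · obtain ⟨i, h1, hin, rfl⟩ := hsurj x
      intro hadj
      refine ⟨i, ?_, rfl⟩
      have : i ≠ 1 := fun e => hadj.ne (by rw [e])
      exact or_iff_not_imp_left.2 fun hne => ⟨by omega, hadj⟩
    · rintro ⟨j, rfl | hj, rfl⟩
      exacts [h.adj_last.symm, hj.2]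
  rw [← SimpleGraph.card_neighborFinset_eq_degree, this, Finset.card_image_of_injOn,
    Finset.card_insert_of_notMem]
  · simp only [Finset.mem_filter, Finset.mem_Icc]
    omega
  · refine h.injOn.mono fun j hj => ?_
    simp only [Finset.coe_insert, Finset.coe_filter, Finset.mem_Icc, Set.mem_insert_iff,
      Set.mem_ofPred_eq] at hj
    simp only [Set.mem_Icc]
    omega

lemma degree_last [Fintype V] [DecidableRel G.Adj] (h : IsCycleLabelling G n u) (hn : 3 ≤ n)
    (hsurj : ∀ x, ∃ i, 1 ≤ i ∧ i ≤ n ∧ u i = x) :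
    G.degree (u n) = Finset.card {j ∈ Finset.Icc 2 (n - 1) | G.Adj (u n) (u j)} + 1 := by
  have hdeg : G.degree (u n) = Finset.card {j ∈ Finset.Icc 2 (n - 1) |
      G.Adj (u n) (u (n + 1 - j))} + 1 := h.reflect.degree_first hn fun x => by
    obtain ⟨i, h1, hin, rfl⟩ := hsurj x
    exact ⟨n + 1 - i, by omega, by omega, by rw [show n + 1 - (n + 1 - i) = i by omega]⟩
  rw [hdeg, Nat.add_right_cancel_iff]
  refine Finset.card_nbij' (fun j => n + 1 - j) (fun j => n + 1 - j) ?_ ?_ ?_ ?_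
  all_goals
    intro j hj
    simp only [Finset.coe_filter, Finset.mem_Icc, Set.mem_ofPred_eq] at hj ⊢
  · exact ⟨by omega, hj.2⟩
  · refine ⟨by omega, ?_⟩
    rw [show n + 1 - (n + 1 - j) = j by omega]
    exact hj.2
  · omega
  · omega

lemma not_adj_chordPartner (h : IsCycleLabelling G n u) {t : ℕ} (ht : 1 ≤ t) (htn : t + 2 ≤ n)
    (hl : ¬ HasCycleLength G (t + 2)) (j : ℕ) (h2 : 2 ≤ j) (hj : j ≤ n - 1)
    (hA : G.Adj (u 1) (u j)) : ¬ G.Adj (u n) (u (chordPartner n t j)) := by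
  intro hB
  apply hl
  unfold chordPartner at hB
  split_ifs at hB with hjt
  · exact h.hasCycleLength_of_fst_snd h2 hj (by omega) (by omega) (by omega) hA hB
  · exact h.hasCycleLength_of_four (i := 2) (p := n - 1) le_rfl (by omega) (by omega) (by omega)
      (by omega) (by omega) le_rfl hj (by omega) (h.adj_two (by omega)) hB
      (h.adj_next_to_last (by omega)) hA

/-- Missing a cycle length forces the two ends to have degree sum at most `n`, with every pair of
positions used in case of equality. -/
lemma degree_add_degree [Fintype V] [DecidableRel G.Adj] (h : IsCycleLabelling G n u)
    (hsurj : ∀ x, ∃ i, 1 ≤ i ∧ i ≤ n ∧ u i = x) {t : ℕ} (ht : 1 ≤ t) (htn : t + 2 ≤ n)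
    (hl : ¬ HasCycleLength G (t + 2)) :
    G.degree (u n) + G.degree (u 1) ≤ n ∧
      (n ≤ G.degree (u n) + G.degree (u 1) → ∀ j, 2 ≤ j → j ≤ n - 1 →
        G.Adj (u 1) (u j) ∨ G.Adj (u n) (u (chordPartner n t j))) := by
  have := card_filter_chordPartner ht htn (fun j => G.Adj (u 1) (u j))
    (fun j => G.Adj (u n) (u j)) (h.not_adj_chordPartner ht htn hl)
  rw [h.degree_first (by omega) hsurj, h.degree_last (by omega) hsurj]
  exact ⟨by omega, fun hle => this.2 (by omega)⟩

lemma chordPattern (h : IsCycleLabelling G n u) {t : ℕ} (ht : 1 ≤ t) (htn : t + 4 ≤ n)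
    (hl : ¬ HasCycleLength G (t + 2))
    (hor : ∀ j, 2 ≤ j → j ≤ n - 1 →
      G.Adj (u 1) (u j) ∨ G.Adj (u n) (u (chordPartner n t j))) :
    ChordPattern n t (fun j => G.Adj (u 1) (u j)) (fun j => G.Adj (u n) (u j)) where
  one_le := ht
  add_four_le := htn
  fst_two := h.adj_two (by omega)
  snd_last := h.adj_next_to_last (by omega)
  not_fst_snd i k hi hin hk hkn hm hA hB :=
    hl (h.hasCycleLength_of_fst_snd hi hin hk hkn (by omega) hA hB)
  not_fst_fst i hi hit hA hA' :=
    hl (h.hasCycleLength_of_fst_fst (k := i + t) hi (by omega) (by omega) (by omega) hA hA')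
  not_snd_snd i hi hit hB hB' := by
    refine hl (h.reflect.hasCycleLength_of_fst_fst (i := n + 1 - (i + t)) (k := n + 1 - i)
      (by omega) (by omega) (by omega) (by omega) ?_ ?_)
    · simpa only [Nat.add_sub_cancel, show n + 1 - (n + 1 - (i + t)) = i + t by omega] using hB'
    · simpa only [Nat.add_sub_cancel, show n + 1 - (n + 1 - i) = i by omega] using hB
  not_four i k p q hi hk hip hiq hkp hkq hpn hqn hm hAi hBk hBp hAq :=
    hl (h.hasCycleLength_of_four hi hk hip hiq hkp hkq hpn hqn (by omega) hAi hBk hBp hAq)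
  fst_or_snd j hj hjt := by
    simpa only [chordPartner, if_pos hjt] using hor j hj (by omega)
  fst_or_snd_wrap k hk hkt := by
    have := hor (k + n - t - 1) (by omega) (by omega)
    rwa [chordPartner, if_neg (by omega),
      show k + n - t - 1 + t + 1 - n = k by omega] at this

/-- If the chords from `u 1` and `u n` alternate and some odd cycle length is missing, then the
parity of the labels is a proper colouring. -/
lemma colorable_two (h : IsCycleLabelling G n u) (hn3 : 3 ≤ n)
    (hsurj : ∀ x, ∃ i, 1 ≤ i ∧ i ≤ n ∧ u i = x) (hn : n % 2 = 0) {l : ℕ} (hl3 : 3 ≤ l)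
    (hln : l ≤ n) (hlodd : l % 2 = 1) (hl : ¬ HasCycleLength G l)
    (hA : ∀ j, 2 ≤ j → j ≤ n - 1 → (G.Adj (u 1) (u j) ↔ j % 2 = 0))
    (hB : ∀ j, 2 ≤ j → j ≤ n - 1 → (G.Adj (u n) (u j) ↔ j % 2 = 1)) : G.Colorable 2 := by
  have key : ∀ p q, 1 ≤ p → p < q → q ≤ n → p % 2 = q % 2 → ¬ G.Adj (u p) (u q) := by
    intro p q hp hpq hq hmod hadj
    obtain rfl | hp2 : p = 1 ∨ 2 ≤ p := by omega
    · have := (hA q (by omega) (by omega)).1 hadj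
      omega
    obtain rfl | hqn : q = n ∨ q ≤ n - 1 := by omega
    · have := (hB p hp2 (by omega)).1 hadj.symm
      omega
    obtain hev | hodd := Nat.mod_two_eq_zero_or_one p
    · exact h.not_adj_of_even hn hl3 hln hlodd hl (fun j h2 hj => (hA j h2 hj).2)
        (fun j h2 hj => (hB j h2 hj).2) hp2 hpq hqn hev (by omega) hadj
    · refine h.reflect.not_adj_of_even hn hl3 hln hlodd hl (fun j h2 hj hj' => ?_)
        (fun j h2 hj hj' => ?_) (p := n + 1 - q) (q := n + 1 - p) (by omega) (by omega) (by omega)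
        (by omega) (by omega) ?_
      · exact (hB (n + 1 - j) (by omega) (by omega)).2 (by omega)
      · rw [show n + 1 - n = 1 by omega]
        exact (hA (n + 1 - j) (by omega) (by omega)).2 (by omega)
      · rw [show n + 1 - (n + 1 - q) = q by omega, show n + 1 - (n + 1 - p) = p by omega]
        exact hadj.symm
  choose f hf1 hfn hfu using hsurj
  refine ⟨SimpleGraph.Coloring.mk (fun x => ⟨f x % 2, Nat.mod_lt _ two_pos⟩)
    fun {x y} hadj e => ?_⟩
  have hmod : f x % 2 = f y % 2 := congrArg Fin.val e
  rw [← hfu x, ← hfu y] at hadj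
  rcases lt_trichotomy (f x) (f y) with hlt | heq | hlt
  · exact key _ _ (hf1 x) hlt (hfn y) hmod hadj
  · exact hadj.ne (by rw [heq])
  · exact key _ _ (hf1 y) hlt (hfn x) hmod.symm hadj.symm

lemma of_zmod {v : ZMod n → V} (hv : Function.Injective v)
    (hcyc : ∀ i : ZMod n, G.Adj (v i) (v (i + 1))) :
    IsCycleLabelling G n (fun i => v (i : ZMod n)) := by
  refine ⟨fun i hi j hj e => ?_, fun i _ _ => ?_, ?_⟩
  · have hmod := (ZMod.natCast_eq_natCast_iff i j n).1 (hv e)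
    obtain ⟨hi1, hin⟩ := hi
    obtain ⟨hj1, hjn⟩ := hj
    have h0 : i - 1 ≡ j - 1 [MOD n] := by
      apply Nat.ModEq.add_right_cancel' 1
      rwa [Nat.sub_add_cancel hi1, Nat.sub_add_cancel hj1]
    have := Nat.ModEq.eq_of_lt_of_lt h0 (by omega) (by omega)
    omega
  · simpa using hcyc i
  · simpa using hcyc 0

end IsCycleLabelling

lemma ZMod.exists_natCast_mem_Icc {n : ℕ} (hn : n ≠ 0) (a : ZMod n) :
    ∃ i : ℕ, 1 ≤ i ∧ i ≤ n ∧ (i : ZMod n) = a := by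
  have : NeZero n := ⟨hn⟩
  by_cases ha : a = 0
  · exact ⟨n, by omega, le_rfl, by simp [ha]⟩
  · exact ⟨a.val, Nat.one_le_iff_ne_zero.2 ((ZMod.val_ne_zero a).2 ha), a.val_lt.le, by simp⟩

/-- Theorem of Hakimi and Schmeichel. Let `G` be a graph of order `n` with a hamiltonian
cycle `v 0, v 1, …, v (n-1), v 0` (encoded as a bijection `v : ZMod n → V` with
consecutive vertices adjacent) in which `d_G(v 0) + d_G(v 1) ≥ n`. Then `G` is pancyclic,
or `G` is bipartite, or `G` has cycles of every length `ℓ` with `3 ≤ ℓ ≤ n` except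
`ℓ = n - 1`. Moreover, if `d_G(v 0) + d_G(v 1) > n`, then `G` is pancyclic. -/
theorem hakimi_schmeichel {V : Type*} [Fintype V] [DecidableEq V]
    (G : SimpleGraph V) [DecidableRel G.Adj] (n : ℕ)
    (hn : n = Fintype.card V) (hn3 : 3 ≤ n)
    (v : ZMod n → V) (hbij : Function.Bijective v)
    (hcyc : ∀ i : ZMod n, G.Adj (v i) (v (i + 1)))
    (hdeg : n ≤ G.degree (v 0) + G.degree (v 1)) :
    ((∀ ℓ : ℕ, 3 ≤ ℓ → ℓ ≤ n → HasCycleLength G ℓ) ∨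
      G.Colorable 2 ∨
      (∀ ℓ : ℕ, 3 ≤ ℓ → ℓ ≤ n → ℓ ≠ n - 1 → HasCycleLength G ℓ)) ∧
    (n < G.degree (v 0) + G.degree (v 1) →
      ∀ ℓ : ℕ, 3 ≤ ℓ → ℓ ≤ n → HasCycleLength G ℓ) := by
  have h := IsCycleLabelling.of_zmod hbij.injective hcyc
  have hsurj : ∀ x, ∃ i : ℕ, 1 ≤ i ∧ i ≤ n ∧ v (i : ZMod n) = x := by
    intro x
    obtain ⟨a, rfl⟩ := hbij.surjective x
    obtain ⟨i, h1, hin, rfl⟩ := ZMod.exists_natCast_mem_Icc (by omega) a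
    exact ⟨i, h1, hin, rfl⟩
  have hdeg_last : G.degree (v (n : ZMod n)) = G.degree (v 0) := by rw [ZMod.natCast_self]
  have hdeg_first : G.degree (v ((1 : ℕ) : ZMod n)) = G.degree (v 1) := by rw [Nat.cast_one]
  rw [← hdeg_last, ← hdeg_first] at hdeg ⊢
  constructor
  · rw [or_iff_not_imp_left, or_iff_not_imp_right]
    intro _ hmiss
    push Not at hmiss
    obtain ⟨l, hl3, hln, hlne, hl⟩ := hmiss
    obtain ⟨t, rfl⟩ : ∃ t, l = t + 2 := ⟨l - 2, by omega⟩
    have hltn : t + 2 ≠ n := fun e => hl (e ▸ h.hasCycleLength_self hn3)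
    have hpat := h.chordPattern (t := t) (by omega) (by omega) hl
      ((h.degree_add_degree hsurj (by omega) hln hl).2 hdeg)
    obtain ⟨hne, hto, hAB⟩ := hpat.alternating
    rw [Nat.odd_iff] at hto
    exact h.colorable_two hn3 hsurj (Nat.even_iff.1 hne) hl3 hln (by omega) hl
      (fun j h2 hj => (hAB j h2 hj).1.trans Nat.even_iff)
      (fun j h2 hj => (hAB j h2 hj).2.trans Nat.odd_iff)
  · intro hgt l hl3 hln
    by_contra hl
    obtain ⟨t, rfl⟩ : ∃ t, l = t + 2 := ⟨l - 2, by omega⟩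
    have := (h.degree_add_degree hsurj (by omega) hln hl).1
    omega
end
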